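/- Let N = 6, m ≥ 2, λ̄ > 0, and let (λ_n) → λ̄ and (u_n) be radial solutions of the Brezis–Nirenberg problem with m nodal zones for λ_n, with first zeros r_n, such that u_n(0) → ∞. Then there exists a function u^{m−1} such that (λ̄, u^{m−1}) solves the overdetermined radial problem u'' + (5/r)u' + |u|u + λ̄u = 0 on (0,1), u'(0) = 0, u(1) = 0, u(0) = −λ̄/2, with exactly m−1 nodal zones; moreover λ̄ is the unique value for which such a solution exists, u_n → u^{m−1} uniformly together with first derivatives on compact subsets of (0,1], and sup_{r_n ≤ r ≤ 1}|u_n(r)| → λ̄/2. -/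

import Mathlib

open Real Set Filter Topology

/-- A radial solution of the Brezis–Nirenberg problem `-Δu = |u|^{4/(N-2)} u + λ u`
on the unit ball of `ℝ^N` with `m` nodal zones: a `C²` function `u` on `[0,1]`
(given together with its first and second derivatives `u'`, `u''`) satisfying the
radial ODE, `u'(0) = 0`, `u(1) = 0`, `u(0) > 0`, with exactly `m - 1` zeros in `(0,1)`. -/
structure BNSol (N : ℕ) (lam : ℝ) (m : ℕ) (u u' u'' : ℝ → ℝ) : Prop where
  deriv_fst : ∀ r ∈ Set.Icc (0:ℝ) 1, HasDerivWithinAt u (u' r) (Set.Icc (0:ℝ) 1) r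
  deriv_snd : ∀ r ∈ Set.Icc (0:ℝ) 1, HasDerivWithinAt u' (u'' r) (Set.Icc (0:ℝ) 1) r
  cont_snd : ContinuousOn u'' (Set.Icc (0:ℝ) 1)
  ode : ∀ r ∈ Set.Ioo (0:ℝ) 1,
    u'' r + (((N:ℝ) - 1) / r) * u' r + |u r| ^ ((4:ℝ) / ((N:ℝ) - 2)) * u r + lam * u r = 0
  bc_deriv_zero : u' 0 = 0
  bc_one : u 1 = 0
  pos_zero : 0 < u 0
  nodal : {r : ℝ | r ∈ Set.Ioo (0:ℝ) 1 ∧ u r = 0}.ncard = m - 1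

/-- `ρ` is the first zero of `u` in `(0,1]`. -/
def IsFirstZero (u : ℝ → ℝ) (ρ : ℝ) : Prop :=
  ρ ∈ Set.Ioc (0:ℝ) 1 ∧ u ρ = 0 ∧ ∀ s ∈ Set.Ioo (0:ℝ) ρ, u s ≠ 0

/-- `(lamBar, w)` solves the overdetermined radial problem in dimension `6`:
`w'' + (5/r)w' + |w|w + lamBar·w = 0` on `(0,1)`, `w'(0) = 0`, `w(1) = 0`,
`w(0) = -lamBar/2`, and `w` has exactly `m - 1` nodal zones (`m - 2` zeros in `(0,1)`). -/
structure OverdetSol (lamBar : ℝ) (m : ℕ) (w w' w'' : ℝ → ℝ) : Prop where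
  lam_pos : 0 < lamBar
  deriv_fst : ∀ r ∈ Set.Icc (0:ℝ) 1, HasDerivWithinAt w (w' r) (Set.Icc (0:ℝ) 1) r
  deriv_snd : ∀ r ∈ Set.Icc (0:ℝ) 1, HasDerivWithinAt w' (w'' r) (Set.Icc (0:ℝ) 1) r
  ode : ∀ r ∈ Set.Ioo (0:ℝ) 1, w'' r + (5 / r) * w' r + |w r| * w r + lamBar * w r = 0
  bc_deriv_zero : w' 0 = 0
  bc_one : w 1 = 0
  val_zero : w 0 = -lamBar / 2
  nodal : {r : ℝ | r ∈ Set.Ioo (0:ℝ) 1 ∧ w r = 0}.ncard = m - 2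


/-- Working form of the radial ODE in dimension 6, as a first order system `(u, v)`. -/
structure RadSol (lam : ℝ) (u v : ℝ → ℝ) : Prop where
  cu : ContinuousOn u (Set.Icc (0:ℝ) 1)
  cv : ContinuousOn v (Set.Icc (0:ℝ) 1)
  du : ∀ r ∈ Set.Ioo (0:ℝ) 1, HasDerivAt u (v r) r
  dv : ∀ r ∈ Set.Ioo (0:ℝ) 1,
    HasDerivAt v (-(5 / r) * v r - (|u r| * u r + lam * u r)) r

lemma hd_congr {f g : ℝ → ℝ} {f' g' x : ℝ} (h : HasDerivAt f f' x) (hfg : ∀ s, g s = f s)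
    (h2 : g' = f') : HasDerivAt g g' x := by
  have : g = f := funext hfg
  rw [this, h2]; exact h

lemma le_of_deriv_nonneg {a b : ℝ} {f f' : ℝ → ℝ} (hc : ContinuousOn f (Set.Icc a b))
    (hd : ∀ x ∈ Set.Ioo a b, HasDerivAt f (f' x) x) (hn : ∀ x ∈ Set.Ioo a b, 0 ≤ f' x)
    {x y : ℝ} (hx : a ≤ x) (hxy : x ≤ y) (hy : y ≤ b) : f x ≤ f y := by
  have : MonotoneOn f (Set.Icc a b) := by
    apply monotoneOn_of_deriv_nonneg (convex_Icc a b) hc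
    · rw [interior_Icc]
      intro z hz
      exact (hd z hz).differentiableAt.differentiableWithinAt
    · rw [interior_Icc]
      intro z hz
      rw [(hd z hz).deriv]
      exact hn z hz
  exact this ⟨hx, hxy.trans hy⟩ ⟨hx.trans hxy, hy⟩ hxy

/-- comparison of two functions through their derivatives -/
lemma sub_le_sub_of_deriv {a b : ℝ} {f f' g g' : ℝ → ℝ} (hc : ContinuousOn f (Set.Icc a b))
    (hcg : ContinuousOn g (Set.Icc a b))
    (hd : ∀ x ∈ Set.Ioo a b, HasDerivAt f (f' x) x)
    (hdg : ∀ x ∈ Set.Ioo a b, HasDerivAt g (g' x) x)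
    (hn : ∀ x ∈ Set.Ioo a b, f' x ≤ g' x) (hab : a ≤ b) : f b - f a ≤ g b - g a := by
  have := le_of_deriv_nonneg (f := fun s => g s - f s) (f' := fun s => g' s - f' s)
    (hcg.sub hc) (fun x hx => (hdg x hx).sub (hd x hx)) (fun x hx => sub_nonneg.2 (hn x hx))
    le_rfl hab le_rfl
  linarith

section phase1
variable {lam ρ : ℝ} {u v : ℝ → ℝ}

lemma RadSol.dY (h : RadSol lam u v) {r : ℝ} (hr : r ∈ Set.Ioo (0:ℝ) 1) :
    HasDerivAt (fun s => s ^ 5 * v s) (-(r ^ 5 * (|u r| * u r + lam * u r))) r := by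
  have h0 : r ≠ 0 := hr.1.ne'
  refine hd_congr ((hasDerivAt_pow 5 r).mul (h.dv r hr)) (fun s => rfl) ?_
  field_simp
  push_cast
  ring

/-- the Pohozaev functional -/
noncomputable def PJ (lam : ℝ) (u v : ℝ → ℝ) (s : ℝ) : ℝ :=
  s ^ 6 * (v s ^ 2 / 2 + u s ^ 3 / 3 + lam * u s ^ 2 / 2) + 2 * s ^ 5 * u s * v s

lemma RadSol.dJ (h : RadSol lam u v) {r : ℝ} (hr : r ∈ Set.Ioo (0:ℝ) 1) (hu : 0 < u r) :
    HasDerivAt (PJ lam u v) (lam * r ^ 5 * u r ^ 2) r := by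
  have h0 : r ≠ 0 := hr.1.ne'
  have hv := h.dv r hr
  rw [abs_of_pos hu] at hv
  have hu1 := h.du r hr
  have := ((hasDerivAt_pow 6 r).mul ((((hv.pow 2).div_const 2).add ((hu1.pow 3).div_const 3)).add
    (((hu1.pow 2).const_mul lam).div_const 2))).add
    ((((hasDerivAt_pow 5 r).const_mul 2).mul hu1).mul hv)
  refine hd_congr this (fun s => rfl) ?_
  simp only [Pi.add_apply, Pi.mul_apply, Pi.pow_apply]
  field_simp
  push_cast
  ring

/-- data of the first nodal zone -/
structure Zone1 (lam ρ : ℝ) (u v : ℝ → ℝ) : Prop where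
  sol : RadSol lam u v
  lam_pos : 0 < lam
  rpos : 0 < ρ
  rle : ρ < 1
  v0 : v 0 = 0
  pos : ∀ r ∈ Set.Ico 0 ρ, 0 < u r
  uz : u ρ = 0

namespace Zone1

lemma mem01 (h : Zone1 lam ρ u v) {r : ℝ} (hr : r ∈ Set.Ioo 0 ρ) : r ∈ Set.Ioo (0:ℝ) 1 := ⟨hr.1, hr.2.trans h.rle⟩

lemma cu (h : Zone1 lam ρ u v) : ContinuousOn u (Set.Icc 0 ρ) := h.sol.cu.mono (Icc_subset_Icc_right h.rle.le)
lemma cv (h : Zone1 lam ρ u v) : ContinuousOn v (Set.Icc 0 ρ) := h.sol.cv.mono (Icc_subset_Icc_right h.rle.le)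
lemma cJ (h : Zone1 lam ρ u v) : ContinuousOn (PJ lam u v) (Set.Icc 0 ρ) := by
  have := h.cu
  have := h.cv
  unfold PJ
  fun_prop

lemma pos' (h : Zone1 lam ρ u v) {r : ℝ} (hr : r ∈ Set.Ioo 0 ρ) : 0 < u r := h.pos r ⟨hr.1.le, hr.2⟩

lemma dY (h : Zone1 lam ρ u v) {r : ℝ} (hr : r ∈ Set.Ioo 0 ρ) :
    HasDerivAt (fun s => s ^ 5 * v s) (-(r ^ 5 * (u r ^ 2 + lam * u r))) r := by
  have := h.sol.dY (h.mem01 hr)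
  rwa [abs_of_pos (h.pos' hr), ← sq] at this

lemma vneg (h : Zone1 lam ρ u v) {r : ℝ} (hr : r ∈ Set.Icc 0 ρ) : v r ≤ 0 := by
  rcases hr.1.eq_or_lt with h0 | h0
  · rw [← h0, h.v0]
  have := sub_le_sub_of_deriv (a := 0) (b := r) (f := fun s => s ^ 5 * v s) (g := fun _ => 0)
    (f' := fun r => -(r ^ 5 * (u r ^ 2 + lam * u r))) (g' := fun _ => 0)
    (by have := h.cv.mono (Icc_subset_Icc_right hr.2); fun_prop) (by fun_prop)
    (fun x hx => h.dY ⟨hx.1, hx.2.trans_le hr.2⟩) (fun x hx => hasDerivAt_const _ _)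
    (fun x hx => by
      have := h.pos' ⟨hx.1, hx.2.trans_le hr.2⟩
      have := h.lam_pos
      have := hx.1
      simp only [Left.neg_nonpos_iff]; positivity) hr.1
  simp at this
  have h5 : 0 < r ^ 5 := by positivity
  by_contra hc
  push Not at hc
  have := mul_pos h5 hc
  linarith

lemma uanti (h : Zone1 lam ρ u v) {x y : ℝ} (hx : 0 ≤ x) (hxy : x ≤ y) (hy : y ≤ ρ) : u y ≤ u x := by
  have := le_of_deriv_nonneg (a := 0) (b := ρ) (f := fun s => - u s) (f' := fun s => - v s)
    h.cu.neg (fun x hx => (h.sol.du x (h.mem01 hx)).neg)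
    (fun x hx => by have := h.vneg (Ioo_subset_Icc_self hx); linarith) hx hxy hy
  simpa using this

lemma u0 (h : Zone1 lam ρ u v) : 0 < u 0 := h.pos 0 ⟨le_rfl, h.rpos⟩

lemma unonneg (h : Zone1 lam ρ u v) {r : ℝ} (hr : r ∈ Set.Icc 0 ρ) : 0 ≤ u r := by
  have := h.uanti hr.1 hr.2 le_rfl
  rwa [h.uz] at this

/-- crude lower bound on `v` -/
lemma vlow (h : Zone1 lam ρ u v) (hA : lam ≤ u 0) {r : ℝ} (hr : r ∈ Set.Icc 0 ρ) : -(u 0 ^ 2 / 3 * r) ≤ v r := by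
  rcases hr.1.eq_or_lt with h0 | h0
  · rw [← h0, h.v0]; simp
  have := sub_le_sub_of_deriv (a := 0) (b := r) (g := fun s => s ^ 5 * v s)
    (f := fun s => -(u 0 ^ 2 / 3) * s ^ 6)
    (g' := fun r => -(r ^ 5 * (u r ^ 2 + lam * u r))) (f' := fun s => -(u 0 ^ 2 / 3) * (((6:ℕ):ℝ) * s ^ 5))
    (by fun_prop) (by have := h.cv.mono (Icc_subset_Icc_right hr.2); fun_prop) 
    (fun x hx => (hasDerivAt_pow 6 x).const_mul _) 
    (fun x hx => h.dY ⟨hx.1, hx.2.trans_le hr.2⟩) 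
    (fun x hx => by
      have h1 := h.pos' ⟨hx.1, hx.2.trans_le hr.2⟩
      have h2 := h.lam_pos
      have h3 := hx.1
      have h4 := h.uanti le_rfl hx.1.le (hx.2.le.trans hr.2)
      have h5 : 0 ≤ x ^ 5 := by positivity
      have h6 : u x ^ 2 + lam * u x ≤ 2 * u 0 ^ 2 := by nlinarith
      have := mul_le_mul_of_nonneg_left h6 h5
      push_cast
      nlinarith) hr.1
  simp at this
  have h5 : 0 < r ^ 5 := by positivity
  have : r ^ 5 * (-(u 0 ^ 2 / 3 * r)) ≤ r ^ 5 * v r := by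
    calc _ = -(u 0 ^ 2 / 3 * r ^ 6) := by ring
      _ ≤ _ := by linarith
  exact le_of_mul_le_mul_left this h5

lemma ulow (h : Zone1 lam ρ u v) (hA : lam ≤ u 0) {r : ℝ} (hr : r ∈ Set.Icc 0 ρ) : u 0 - u 0 ^ 2 / 6 * r ^ 2 ≤ u r := by
  have := sub_le_sub_of_deriv (a := 0) (b := r) (g := u)
    (f := fun s => -(u 0 ^ 2 / 6) * s ^ 2)
    (g' := v) (f' := fun s => -(u 0 ^ 2 / 6) * (((2:ℕ):ℝ) * s ^ 1))
    (by fun_prop) (h.cu.mono (Icc_subset_Icc_right hr.2))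
    (fun x hx => (hasDerivAt_pow 2 x).const_mul _) 
    (fun x hx => h.sol.du x (h.mem01 ⟨hx.1, hx.2.trans_le hr.2⟩)) 
    (fun x hx => by
      have h1 := h.vlow hA (r := x) ⟨hx.1.le, hx.2.le.trans hr.2⟩
      push_cast
      linarith) hr.1
  simp at this
  linarith

lemma Jlow (h : Zone1 lam ρ u v) (hA : lam ≤ u 0) : 9 * lam / (8 * u 0) ≤ PJ lam u v ρ := by
  have hu0 := h.u0
  have hl := h.lam_pos
  set σ := Real.sqrt (3 / u 0) with hσ
  have hσ2 : σ ^ 2 = 3 / u 0 := Real.sq_sqrt (by positivity)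
  have hσ0 : 0 < σ := Real.sqrt_pos.2 (by positivity)
  have hρ := h.rpos
  have hσρ : σ ≤ ρ := by
    have := h.ulow hA (r := ρ) ⟨hρ.le, le_rfl⟩
    rw [h.uz] at this
    have h1 : u 0 * (6 - u 0 * ρ ^ 2) ≤ 0 := by nlinarith
    have h2 : 6 - u 0 * ρ ^ 2 ≤ 0 := by
      by_contra hc
      push Not at hc
      have := mul_pos hu0 hc
      linarith
    apply le_of_sq_le_sq _ hρ.le
    rw [hσ2, div_le_iff₀ hu0]
    linarith
  have hJ1 : PJ lam u v σ ≤ PJ lam u v ρ :=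
    le_of_deriv_nonneg h.cJ (fun x hx => h.sol.dJ (h.mem01 hx) (h.pos' hx))
      (fun x hx => by have := hx.1; positivity) hσ0.le hσρ le_rfl
  have := sub_le_sub_of_deriv (a := 0) (b := σ) (g := PJ lam u v)
    (f := fun s => lam * u 0 ^ 2 / 24 * s ^ 6)
    (g' := fun r => lam * r ^ 5 * u r ^ 2) (f' := fun s => lam * u 0 ^ 2 / 24 * (((6:ℕ):ℝ) * s ^ 5))
    (by fun_prop) (h.cJ.mono (Icc_subset_Icc_right hσρ))
    (fun x hx => (hasDerivAt_pow 6 x).const_mul _) 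
    (fun x hx => h.sol.dJ (h.mem01 ⟨hx.1, hx.2.trans_le hσρ⟩) (h.pos' ⟨hx.1, hx.2.trans_le hσρ⟩)) 
    (fun x hx => by
      have h1 := h.ulow hA (r := x) ⟨hx.1.le, hx.2.le.trans hσρ⟩
      have h2 : x ^ 2 ≤ 3 / u 0 := by
        rw [← hσ2]; exact pow_le_pow_left₀ hx.1.le hx.2.le 2
      have h3 : u 0 / 2 ≤ u x := by
        have : u 0 ^ 2 / 6 * x ^ 2 ≤ u 0 ^ 2 / 6 * (3 / u 0) := by gcongr
        have h4 : u 0 ^ 2 / 6 * (3 / u 0) = u 0 / 2 := by field_simp; norm_num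
        linarith
      have h4 : (u 0 / 2) ^ 2 ≤ u x ^ 2 := by gcongr
      have hx0 := hx.1
      have : lam * x ^ 5 * (u 0 / 2) ^ 2 ≤ lam * x ^ 5 * u x ^ 2 := by gcongr
      push_cast
      linarith) hσ0.le
  have h0 : PJ lam u v 0 = 0 := by simp [PJ]
  rw [h0] at this
  have h6 : σ ^ 6 = (3 / u 0) ^ 3 := by rw [← hσ2]; ring
  simp only [h6] at this
  have h7 : lam * u 0 ^ 2 / 24 * (3 / u 0) ^ 3 = 9 * lam / (8 * u 0) := by field_simp; norm_num
  rw [h7] at this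
  norm_num at this
  linarith

end Zone1
end phase1

section phase1b
variable {lam ρ : ℝ} {u v : ℝ → ℝ}
namespace Zone1

/-- monotone auxiliary functional -/
lemma Snonneg (h : Zone1 lam ρ u v) {r : ℝ} (hr : r ∈ Set.Icc 0 ρ) :
    lam * r ^ 6 * u r ^ 2 / 2 ≤ 3 * PJ lam u v r := by
  have := sub_le_sub_of_deriv (a := 0) (b := r) (g := fun s => 3 * PJ lam u v s)
    (f := fun s => lam * s ^ 6 * u s ^ 2 / 2)
    (g' := fun r => 3 * (lam * r ^ 5 * u r ^ 2))
    (f' := fun s => 3 * (lam * s ^ 5 * u s ^ 2) + lam * s ^ 6 * u s * v s)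
    (by have := h.cu.mono (Icc_subset_Icc_right hr.2); fun_prop)
    (by have := h.cJ.mono (Icc_subset_Icc_right hr.2); fun_prop)
    (fun x hx => by
      have hx' : x ∈ Set.Ioo 0 ρ := ⟨hx.1, hx.2.trans_le hr.2⟩
      refine hd_congr ((((hasDerivAt_pow 6 x).const_mul lam).mul
        ((h.sol.du x (h.mem01 hx')).pow 2)).div_const 2) (fun s => rfl) ?_
      simp only [Pi.pow_apply]
      push_cast
      ring)
    (fun x hx => (h.sol.dJ (h.mem01 ⟨hx.1, hx.2.trans_le hr.2⟩)
      (h.pos' ⟨hx.1, hx.2.trans_le hr.2⟩)).const_mul 3)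
    (fun x hx => by
      have hx' : x ∈ Set.Ioo 0 ρ := ⟨hx.1, hx.2.trans_le hr.2⟩
      have h1 := h.pos' hx'
      have h2 := h.vneg (Ioo_subset_Icc_self hx')
      have h3 := h.lam_pos
      have h4 := hx.1
      have : lam * x ^ 6 * u x * v x ≤ 0 := mul_nonpos_of_nonneg_of_nonpos (by positivity) h2
      linarith) hr.1
  have h0 : PJ lam u v 0 = 0 := by simp [PJ]
  rw [h0] at this
  norm_num at this
  linarith

lemma Ylow (h : Zone1 lam ρ u v) {r : ℝ} (hr : r ∈ Set.Icc 0 ρ) :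
    r ^ 6 * u r ^ 2 / 6 ≤ -(r ^ 5 * v r) := by
  have := sub_le_sub_of_deriv (a := 0) (b := r) (g := fun s => -(s ^ 5 * v s))
    (f := fun s => s ^ 6 * u s ^ 2 / 6)
    (g' := fun r => -(-(r ^ 5 * (u r ^ 2 + lam * u r))))
    (f' := fun s => s ^ 5 * u s ^ 2 + s ^ 6 * u s * v s / 3)
    (by have := h.cu.mono (Icc_subset_Icc_right hr.2); fun_prop)
    (by have := h.cv.mono (Icc_subset_Icc_right hr.2); fun_prop)
    (fun x hx => by
      have hx' : x ∈ Set.Ioo 0 ρ := ⟨hx.1, hx.2.trans_le hr.2⟩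
      refine hd_congr (((hasDerivAt_pow 6 x).mul
        ((h.sol.du x (h.mem01 hx')).pow 2)).div_const 6) (fun s => rfl) ?_
      simp only [Pi.pow_apply]
      push_cast
      ring)
    (fun x hx => (h.dY ⟨hx.1, hx.2.trans_le hr.2⟩).neg)
    (fun x hx => by
      have hx' : x ∈ Set.Ioo 0 ρ := ⟨hx.1, hx.2.trans_le hr.2⟩
      have h1 := h.pos' hx'
      have h2 := h.vneg (Ioo_subset_Icc_self hx')
      have h3 := h.lam_pos
      have h4 := hx.1
      have h5 : x ^ 6 * u x * v x ≤ 0 := mul_nonpos_of_nonneg_of_nonpos (by positivity) h2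
      have h6 : 0 ≤ x ^ 5 * (lam * u x) := by positivity
      nlinarith) hr.1
  norm_num at this
  linarith

/-- `T = (r^5 v)^2 / (r^12 u^3)` is nondecreasing, hence at least `u 0 / 36` -/
lemma Tlow (h : Zone1 lam ρ u v) {r : ℝ} (hr : r ∈ Set.Ioo 0 ρ) :
    u 0 / 36 * (r ^ 2 * u r ^ 3) ≤ v r ^ 2 := by
  have key : ∀ e ∈ Set.Ioo 0 r, u e / 36 ≤ v r ^ 2 / (r ^ 2 * u r ^ 3) := by
    intro e he
    have hsub : Set.Icc e r ⊆ Set.Ioo 0 ρ := fun x hx => ⟨he.1.trans_le hx.1, hx.2.trans_lt hr.2⟩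
    have hmono := le_of_deriv_nonneg (a := e) (b := r)
      (f := fun s => (s ^ 5 * v s) ^ 2 / (s ^ 12 * u s ^ 3))
      (f' := fun s => 2 * (-(s ^ 5 * v s)) *
        (3 * PJ lam u v s - lam * s ^ 6 * u s ^ 2 / 2) / (s ^ 13 * u s ^ 4))
      (by
        have h1 := h.cu.mono (hsub.trans Ioo_subset_Icc_self)
        have h2 := h.cv.mono (hsub.trans Ioo_subset_Icc_self)
        apply ContinuousOn.div
        · fun_prop
        · fun_prop
        · intro x hx
          have := h.pos' (hsub hx)
          have := (hsub hx).1
          positivity)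
      (fun x hx => by
        have hx' := hsub (Ioo_subset_Icc_self hx)
        have h1 := h.pos' hx'
        have h2 := hx'.1
        refine hd_congr (((h.dY hx').pow 2).div ((hasDerivAt_pow 12 x).mul
          ((h.sol.du x (h.mem01 hx')).pow 3)) (by simp; exact ⟨h2.ne', h1.ne'⟩)) (fun s => rfl) ?_
        simp only [Pi.pow_apply, Pi.mul_apply, PJ]
        field_simp
        push_cast
        ring)
      (fun x hx => by
        have hx' := hsub (Ioo_subset_Icc_self hx)
        have h1 := h.pos' hx'
        have h2 := hx'.1
        have h3 := h.Snonneg (Ioo_subset_Icc_self hx')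
        have h4 := h.vneg (Ioo_subset_Icc_self hx')
        have h5 : 0 ≤ -(x ^ 5 * v x) := by
          have := mul_nonneg (pow_nonneg h2.le 5) (neg_nonneg.2 h4)
          linarith
        have h6 : 0 ≤ 3 * PJ lam u v x - lam * x ^ 6 * u x ^ 2 / 2 := by linarith
        positivity) le_rfl he.2.le le_rfl
    have he' : e ∈ Set.Ioo 0 ρ := hsub ⟨le_rfl, he.2.le⟩
    have hue := h.pos' he'
    have hur := h.pos' hr
    have he0 := he.1
    have hr0 := hr.1
    have h1 := h.Ylow (Ioo_subset_Icc_self he')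
    have h2 : (e ^ 6 * u e ^ 2 / 6) ^ 2 ≤ (e ^ 5 * v e) ^ 2 := by
      rw [← neg_sq (e ^ 5 * v e)]
      gcongr
    have h3 : u e / 36 ≤ (e ^ 5 * v e) ^ 2 / (e ^ 12 * u e ^ 3) := by
      rw [le_div_iff₀ (by positivity)]
      calc _ = (e ^ 6 * u e ^ 2 / 6) ^ 2 := by ring
        _ ≤ _ := h2
    have h4 : (r ^ 5 * v r) ^ 2 / (r ^ 12 * u r ^ 3) = v r ^ 2 / (r ^ 2 * u r ^ 3) := by
      field_simp
    linarith
  have hur := h.pos' hr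
  have hr0 := hr.1
  rw [← le_div_iff₀ (by positivity)]
  have ht : Tendsto (fun e => u e / 36) (𝓝[>] 0) (𝓝 (u 0 / 36)) := by
    have : ContinuousWithinAt u (Set.Icc 0 ρ) 0 := h.cu 0 ⟨le_rfl, h.rpos.le⟩
    have h2 : Tendsto u (𝓝[>] 0) (𝓝 (u 0)) := by
      have h3 := this.mono_left (nhdsWithin_mono 0 (Ioo_subset_Icc_self (a := 0) (b := ρ)))
      rwa [nhdsWithin_Ioo_eq_nhdsGT h.rpos] at h3
    exact h2.div_const 36
  refine le_of_tendsto ht ?_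
  filter_upwards [Ioo_mem_nhdsGT hr0] with e he using key e he

/-- the Atkinson–Peletier upper bound -/
lemma uup (h : Zone1 lam ρ u v) {r : ℝ} (hr : r ∈ Set.Icc 0 ρ) :
    u r * (1 + u 0 * r ^ 2 / 24) ^ 2 ≤ u 0 := by
  have hA := h.u0
  rcases hr.2.eq_or_lt with h1 | h1
  · rw [h1, h.uz]; linarith
  have hsub : Set.Icc 0 r ⊆ Set.Ico 0 ρ := fun x hx => ⟨hx.1, hx.2.trans_lt h1⟩
  have hcu := h.cu.mono (hsub.trans Ico_subset_Icc_self)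
  have := sub_le_sub_of_deriv (a := 0) (b := r) (g := fun s => (Real.sqrt (u s))⁻¹)
    (f := fun s => Real.sqrt (u 0) / 24 * s ^ 2)
    (g' := fun s => - (v s / (2 * Real.sqrt (u s))) / (Real.sqrt (u s)) ^ 2)
    (f' := fun s => Real.sqrt (u 0) / 24 * (((2:ℕ):ℝ) * s ^ 1))
    (by fun_prop)
    (by
      apply ContinuousOn.inv₀
      · exact hcu.sqrt
      · intro x hx
        exact (Real.sqrt_pos.2 (h.pos x (hsub hx))).ne')
    (fun x hx => (hasDerivAt_pow 2 x).const_mul _)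
    (fun x hx => by
      have hx' : x ∈ Set.Ioo 0 ρ := ⟨hx.1, hx.2.trans h1⟩
      have hp := h.pos' hx'
      exact ((h.sol.du x (h.mem01 hx')).sqrt hp.ne').inv (Real.sqrt_pos.2 hp).ne')
    (fun x hx => by
      have hx' : x ∈ Set.Ioo 0 ρ := ⟨hx.1, hx.2.trans h1⟩
      have hp := h.pos' hx'
      have hx0 := hx.1
      have h2 := h.Tlow hx'
      have h3 := h.vneg (Ioo_subset_Icc_self hx')
      have hs := Real.sqrt_pos.2 hp
      have hs0 := Real.sqrt_pos.2 hA
      have e1 : u x = Real.sqrt (u x) ^ 2 := (Real.sq_sqrt hp.le).symm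
      have e2 : u 0 = Real.sqrt (u 0) ^ 2 := (Real.sq_sqrt hA.le).symm
      have h4 : Real.sqrt (u 0) / 6 * (x * Real.sqrt (u x) ^ 3) ≤ -v x := by
        apply le_of_sq_le_sq _ (by linarith)
        calc _ = (Real.sqrt (u 0) ^ 2) / 36 * (x ^ 2 * (Real.sqrt (u x) ^ 2) ^ 3) := by ring
          _ = u 0 / 36 * (x ^ 2 * u x ^ 3) := by rw [← e1, ← e2]
          _ ≤ v x ^ 2 := h2
          _ = _ := by ring
      have h5 : -(v x / (2 * Real.sqrt (u x))) / (Real.sqrt (u x)) ^ 2 =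
          (-v x) / (2 * Real.sqrt (u x) ^ 3) := by field_simp
      rw [h5, le_div_iff₀ (by positivity)]
      push_cast
      nlinarith) hr.1
  have hp := h.pos r ⟨hr.1, h1⟩
  have hs := Real.sqrt_pos.2 hp
  have hs0 := Real.sqrt_pos.2 hA
  have e1 : u r = Real.sqrt (u r) ^ 2 := (Real.sq_sqrt hp.le).symm
  have e2 : u 0 = Real.sqrt (u 0) ^ 2 := (Real.sq_sqrt hA.le).symm
  have hg : Real.sqrt (u 0) / 24 * r ^ 2 + (Real.sqrt (u 0))⁻¹ ≤ (Real.sqrt (u r))⁻¹ := by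
    norm_num at this
    linarith
  have h6 : Real.sqrt (u r) * (1 + u 0 * r ^ 2 / 24) ≤ Real.sqrt (u 0) := by
    have := mul_le_mul_of_nonneg_left hg (mul_pos hs hs0).le
    calc Real.sqrt (u r) * (1 + u 0 * r ^ 2 / 24) = Real.sqrt (u r) * (1 + Real.sqrt (u 0) ^ 2 * r ^ 2 / 24) := by
          rw [← e2]
      _ = Real.sqrt (u r) * Real.sqrt (u 0) * (Real.sqrt (u 0) / 24 * r ^ 2 + (Real.sqrt (u 0))⁻¹) := by
          field_simp
          ring
      _ ≤ _ := this
      _ = Real.sqrt (u 0) := by field_simp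
  calc u r * (1 + u 0 * r ^ 2 / 24) ^ 2 = (Real.sqrt (u r) * (1 + u 0 * r ^ 2 / 24)) ^ 2 := by
        rw [mul_pow, ← e1]
    _ ≤ Real.sqrt (u 0) ^ 2 := by gcongr
    _ = u 0 := e2.symm

lemma Jup (h : Zone1 lam ρ u v) : PJ lam u v ρ ≤ 2304 * lam / u 0 := by
  have hA := h.u0
  have hl := h.lam_pos
  have hρ := h.rpos
  have := sub_le_sub_of_deriv (a := 0) (b := ρ) (f := PJ lam u v)
    (g := fun s => lam * u 0 ^ 2 / 6 * (s ^ 6 / (1 + u 0 / 24 * s ^ 2) ^ 3))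
    (f' := fun r => lam * r ^ 5 * u r ^ 2)
    (g' := fun s => lam * u 0 ^ 2 / 6 * (6 * s ^ 5 / (1 + u 0 / 24 * s ^ 2) ^ 4))
    h.cJ
    (by
      apply ContinuousOn.mul continuousOn_const
      apply ContinuousOn.div (by fun_prop) (by fun_prop)
      intro x hx
      positivity)
    (fun x hx => h.sol.dJ (h.mem01 hx) (h.pos' hx))
    (fun x hx => by
      have hne : (1 + u 0 / 24 * x ^ 2) ≠ 0 := by positivity
      refine (HasDerivAt.const_mul _ (hd_congr ((hasDerivAt_pow 6 x).div
        ((((hasDerivAt_pow 2 x).const_mul (u 0 / 24)).const_add 1).pow 3)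
        (pow_ne_zero 3 hne)) (fun s => rfl) ?_))
      simp only [Pi.pow_apply]
      field_simp
      push_cast
      ring)
    (fun x hx => by
      have hp := h.pos' hx
      have hx0 := hx.1
      have h2 := h.uup (Ioo_subset_Icc_self hx)
      have h3 : (u x * (1 + u 0 * x ^ 2 / 24) ^ 2) ^ 2 ≤ u 0 ^ 2 := by gcongr
      have h4 : lam * u 0 ^ 2 / 6 * (6 * x ^ 5 / (1 + u 0 / 24 * x ^ 2) ^ 4) =
        lam * x ^ 5 * u 0 ^ 2 / (1 + u 0 / 24 * x ^ 2) ^ 4 := by ring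
      rw [h4, le_div_iff₀ (by positivity)]
      calc _ = lam * x ^ 5 * (u x * (1 + u 0 * x ^ 2 / 24) ^ 2) ^ 2 := by ring
        _ ≤ _ := by gcongr) hρ.le
  have h0 : PJ lam u v 0 = 0 := by simp [PJ]
  rw [h0] at this
  have h5 : lam * u 0 ^ 2 / 6 * (ρ ^ 6 / (1 + u 0 / 24 * ρ ^ 2) ^ 3) ≤ 2304 * lam / u 0 := by
    have : ρ ^ 6 / (1 + u 0 / 24 * ρ ^ 2) ^ 3 ≤ ρ ^ 6 / (u 0 / 24 * ρ ^ 2) ^ 3 := by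
      gcongr
      linarith
    calc _ ≤ lam * u 0 ^ 2 / 6 * (ρ ^ 6 / (u 0 / 24 * ρ ^ 2) ^ 3) := by gcongr
      _ = _ := by field_simp; norm_num
  norm_num at this
  linarith

lemma Kup (h : Zone1 lam ρ u v) :
    lam * (-(ρ ^ 5 * v ρ)) - PJ lam u v ρ ≤ 288 * lam ^ 2 * ρ ^ 2 / u 0 ∧
    0 ≤ lam * (-(ρ ^ 5 * v ρ)) - PJ lam u v ρ := by
  have hA := h.u0
  have hl := h.lam_pos
  have hρ := h.rpos
  have hd : ∀ x ∈ Set.Ioo 0 ρ, HasDerivAt (fun s => lam * (-(s ^ 5 * v s)) - PJ lam u v s)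
      (lam ^ 2 * x ^ 5 * u x) x := by
    intro x hx
    refine hd_congr (((h.dY hx).neg.const_mul lam).sub
      (h.sol.dJ (h.mem01 hx) (h.pos' hx))) (fun s => rfl) ?_
    ring
  have hc : ContinuousOn (fun s => lam * (-(s ^ 5 * v s)) - PJ lam u v s) (Set.Icc 0 ρ) := by
    have h1 := h.cJ
    have h2 := h.cv
    fun_prop
  have h0 : PJ lam u v 0 = 0 := by simp [PJ]
  constructor
  · have := sub_le_sub_of_deriv (g := fun s => 288 * lam ^ 2 / u 0 * s ^ 2)
      (g' := fun s => 288 * lam ^ 2 / u 0 * (((2:ℕ):ℝ) * s ^ 1)) hc (by fun_prop) hd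
      (fun x hx => (hasDerivAt_pow 2 x).const_mul _)
      (fun x hx => by
        have hp := h.pos' hx
        have hx0 := hx.1
        have h2 := h.uup (Ioo_subset_Icc_self hx)
        have h3 : u x * (u 0 * x ^ 2 / 24) ^ 2 ≤ u 0 := by
          refine le_trans ?_ h2
          gcongr
          linarith
        have h4 : 288 * lam ^ 2 / u 0 * (((2:ℕ):ℝ) * x ^ 1) =
          (lam ^ 2 * x * 576 / u 0 ^ 2) * u 0 := by push_cast; field_simp; norm_num
        rw [h4]
        calc lam ^ 2 * x ^ 5 * u x = (lam ^ 2 * x * 576 / u 0 ^ 2) * (u x * (u 0 * x ^ 2 / 24) ^ 2) := by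
              field_simp; norm_num
          _ ≤ _ := by gcongr) hρ.le
    norm_num [h0] at this
    calc _ ≤ 288 * lam ^ 2 / u 0 * ρ ^ 2 := by linarith
      _ = _ := by ring
  · have := le_of_deriv_nonneg hc hd (fun x hx => by
      have := h.pos' hx
      have := hx.1
      positivity) le_rfl hρ.le le_rfl
    simpa [h0] using this

/-- main output of the analysis in the first nodal zone -/
lemma main (h : Zone1 lam ρ u v) (hA : lam ≤ u 0) :
    0 < -(ρ * v ρ) ∧ -(ρ * v ρ) ≤ 2 * lam ∧ 2 * lam - 512 * lam ^ 2 * ρ ^ 2 ≤ -(ρ * v ρ) ∧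
    ρ ^ 4 * (9 / 4 * lam * u 0) ≤ (2304 + 288 * lam) ^ 2 := by
  obtain ⟨k1, k2⟩ := h.Kup
  have j1 := h.Jlow hA
  have j2 := h.Jup
  have hA0 := h.u0
  have hl := h.lam_pos
  have hρ := h.rpos
  set X := -(ρ * v ρ) with hX
  have hJ : PJ lam u v ρ = ρ ^ 4 * X ^ 2 / 2 := by
    simp only [PJ, h.uz, hX]; ring
  have hY : -(ρ ^ 5 * v ρ) = ρ ^ 4 * X := by rw [hX]; ring
  rw [hJ] at j1 j2
  rw [hJ, hY] at k1 k2
  have hρ4 : 0 < ρ ^ 4 := by positivity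
  have hjpos : 0 < 9 * lam / (8 * u 0) := by positivity
  have hX0 : 0 ≤ X := by
    have := h.vneg (r := ρ) ⟨hρ.le, le_rfl⟩
    have := mul_nonneg hρ.le (neg_nonneg.2 this)
    linarith
  have hXp : 0 < X := by
    rcases hX0.eq_or_lt with h1 | h1
    · rw [← h1] at j1; norm_num at j1; linarith
    · exact h1
  have hX2 : X ≤ 2 * lam := by
    by_contra hc
    push Not at hc
    have : 0 < ρ ^ 4 * X * (X - 2 * lam) := by have : 0 < X - 2 * lam := by linarith
                                               positivity
    nlinarith
  refine ⟨hXp, hX2, ?_, ?_⟩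
  · -- ρ^4 X (2λ - X)/2 = K ≤ 288 λ² ρ²/A
    have a1 : ρ ^ 4 * X * (2 * lam - X) ≤ 2 * (288 * lam ^ 2 * ρ ^ 2 / u 0) := by nlinarith
    -- lower bound ρ^4 X ≥ 2 J/(2 lam)
    have a2 : 9 / (8 * u 0) ≤ ρ ^ 4 * X := by
      have : 9 * lam / (8 * u 0) ≤ ρ ^ 4 * X * lam := by
        have : ρ ^ 4 * X ^ 2 / 2 ≤ ρ ^ 4 * X * lam := by
          have : ρ ^ 4 * X * X ≤ ρ ^ 4 * X * (2 * lam) := by gcongr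
          nlinarith
        linarith
      have e : 9 * lam / (8 * u 0) = 9 / (8 * u 0) * lam := by ring
      rw [e] at this
      exact le_of_mul_le_mul_right this hl
    have a3 : 9 / (8 * u 0) * (2 * lam - X) ≤ 9 / (8 * u 0) * (512 * lam ^ 2 * ρ ^ 2) := by
      calc _ ≤ ρ ^ 4 * X * (2 * lam - X) := by
            apply mul_le_mul_of_nonneg_right a2; linarith
        _ ≤ _ := a1
        _ = _ := by field_simp; norm_num
    have := le_of_mul_le_mul_left a3 (by positivity)
    linarith
  · have b1 : lam * (ρ ^ 4 * X) ≤ (2304 * lam + 288 * lam ^ 2) / u 0 := by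
      have : ρ ^ 2 ≤ 1 := by
        have := h.rle
        nlinarith
      have : 288 * lam ^ 2 * ρ ^ 2 / u 0 ≤ 288 * lam ^ 2 * 1 / u 0 := by gcongr
      rw [mul_one] at this
      rw [add_div]
      linarith
    have b2 : (lam * (ρ ^ 4 * X)) ^ 2 ≤ ((2304 * lam + 288 * lam ^ 2) / u 0) ^ 2 := by gcongr
    have b3 : lam ^ 2 * ρ ^ 4 * 2 * (9 * lam / (8 * u 0)) ≤ (lam * (ρ ^ 4 * X)) ^ 2 := by
      calc _ ≤ lam ^ 2 * ρ ^ 4 * 2 * (ρ ^ 4 * X ^ 2 / 2) := by gcongr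
        _ = _ := by ring
    have b4 := b3.trans b2
    have b5 : (lam ^ 2 / u 0 ^ 2) * (ρ ^ 4 * (9 / 4 * lam * u 0)) ≤
        (lam ^ 2 / u 0 ^ 2) * (2304 + 288 * lam) ^ 2 := by
      calc _ = lam ^ 2 * ρ ^ 4 * 2 * (9 * lam / (8 * u 0)) := by field_simp; norm_num
        _ ≤ _ := b4
        _ = _ := by field_simp
    exact le_of_mul_le_mul_left b5 (by positivity)

end Zone1
end phase1b

/-- data of the second nodal zone, on `[ρ, s]` -/
structure Zone2 (lam ρ s : ℝ) (u v : ℝ → ℝ) : Prop where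
  sol : RadSol lam u v
  lam_pos : 0 < lam
  rpos : 0 < ρ
  rs : ρ < s
  sle : s ≤ 1
  uz : u ρ = 0
  np : ∀ r ∈ Set.Icc ρ s, u r ≤ 0
  X0 : 0 < -(ρ * v ρ)
  X2 : -(ρ * v ρ) ≤ 2 * lam

namespace Zone2
variable {lam ρ s : ℝ} {u v : ℝ → ℝ}

lemma sub (h : Zone2 lam ρ s u v) {r : ℝ} (hr : r ∈ Set.Icc ρ s) :
    Set.Icc ρ r ⊆ Set.Icc 0 1 :=
  Icc_subset_Icc h.rpos.le (hr.2.trans h.sle)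

lemma mem (h : Zone2 lam ρ s u v) {r x : ℝ} (hr : r ∈ Set.Icc ρ s) (hx : x ∈ Set.Ioo ρ r) :
    x ∈ Set.Ioo (0:ℝ) 1 := ⟨h.rpos.trans hx.1, hx.2.trans_le (hr.2.trans h.sle)⟩

lemma Ylow (h : Zone2 lam ρ s u v) {r : ℝ} (hr : r ∈ Set.Icc ρ s) :
    ρ ^ 5 * v ρ ≤ r ^ 5 * v r := by
  refine le_of_deriv_nonneg (a := ρ) (b := r) (f := fun s => s ^ 5 * v s)
    (f' := fun r => -(r ^ 5 * (|u r| * u r + lam * u r)))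
    (by have := h.sol.cv.mono (h.sub hr); fun_prop)
    (fun x hx => h.sol.dY (h.mem hr hx))
    (fun x hx => ?_) le_rfl hr.1 le_rfl
  have h1 := h.np x ⟨hx.1.le, hx.2.le.trans hr.2⟩
  have h2 := (h.mem hr hx).1
  have h3 := h.lam_pos
  have h4 : 0 ≤ (|u x| + lam) * (- u x) := mul_nonneg (by positivity) (by linarith)
  have h5 : 0 ≤ x ^ 5 := by positivity
  nlinarith [mul_nonneg h5 h4]

lemma dpsi {x : ℝ} (hx : 0 < x) (c : ℝ) :
    HasDerivAt (fun t => c / 4 * (1 - (ρ / t) ^ 4)) (c * ρ ^ 4 / x ^ 5) x := by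
  have hx0 : x ≠ 0 := hx.ne'
  have := (((((hasDerivAt_const x ρ).div (hasDerivAt_id x) hx0).pow 4).const_sub 1).const_mul (c / 4))
  refine hd_congr this (fun s => rfl) ?_
  simp
  field_simp

lemma cpsi (h : Zone2 lam ρ s u v) (r : ℝ) (c : ℝ) :
    ContinuousOn (fun t => c / 4 * (1 - (ρ / t) ^ 4)) (Set.Icc ρ r) :=
  fun _ hx => (dpsi (h.rpos.trans_le hx.1) c).continuousAt.continuousWithinAt

lemma ulow (h : Zone2 lam ρ s u v) {r : ℝ} (hr : r ∈ Set.Icc ρ s) :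
    (ρ * v ρ) / 4 * (1 - (ρ / r) ^ 4) ≤ u r := by
  have := sub_le_sub_of_deriv (a := ρ) (b := r) (g := u) (g' := v)
    (h.cpsi r (ρ * v ρ)) (h.sol.cu.mono (h.sub hr))
    (fun x hx => dpsi (h.mem hr hx).1 _)
    (fun x hx => h.sol.du x (h.mem hr hx))
    (fun x hx => by
      have h1 := h.Ylow (r := x) ⟨hx.1.le, hx.2.le.trans hr.2⟩
      have h2 := (h.mem hr hx).1
      rw [div_le_iff₀ (by positivity)]
      linarith) hr.1
  have h0 := h.rpos
  rw [h.uz, div_self h0.ne'] at this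
  norm_num at this
  linarith

lemma ulow' (h : Zone2 lam ρ s u v) {r : ℝ} (hr : r ∈ Set.Icc ρ s) : (ρ * v ρ) / 4 ≤ u r := by
  have h1 := h.ulow hr
  have h0 := h.rpos
  have h2 : 0 ≤ (ρ / r) ^ 4 := by have := h0.trans_le hr.1; positivity
  have := h.X0
  nlinarith

lemma vup (h : Zone2 lam ρ s u v) {r : ℝ} (hr : r ∈ Set.Icc ρ s) :
    r ^ 5 * v r ≤ ρ ^ 5 * v ρ + lam ^ 2 * (r ^ 5 * (r - ρ)) := by
  have := sub_le_sub_of_deriv (a := ρ) (b := r) (f := fun s => s ^ 5 * v s)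
    (f' := fun r => -(r ^ 5 * (|u r| * u r + lam * u r)))
    (g := fun r => lam ^ 2 * (r ^ 5 * (r - ρ)))
    (g' := fun r => lam ^ 2 * (((5:ℕ):ℝ) * r ^ 4 * (r - ρ) + r ^ 5 * 1))
    (by have := h.sol.cv.mono (h.sub hr); fun_prop) (by fun_prop)
    (fun x hx => h.sol.dY (h.mem hr hx))
    (fun x hx => HasDerivAt.const_mul _ ((hasDerivAt_pow 5 x).mul ((hasDerivAt_id x).sub_const ρ)))
    (fun x hx => by
      have hx' : x ∈ Set.Icc ρ s := ⟨hx.1.le, hx.2.le.trans hr.2⟩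
      have h1 := h.np x hx'
      have h2 := (h.mem hr hx).1
      have h3 := h.lam_pos
      have h4 := h.ulow' hx'
      have h5 := h.X2
      have h6 : -(lam / 2) ≤ u x := by linarith
      have h7 : -(|u x| * u x + lam * u x) ≤ lam ^ 2 := by
        rw [abs_of_nonpos h1]
        nlinarith
      have h8 : 0 ≤ x - ρ := by linarith [hx.1]
      have h9 : 0 ≤ lam ^ 2 * (((5:ℕ):ℝ) * x ^ 4 * (x - ρ)) := by positivity
      have h10 : x ^ 5 * (-(|u x| * u x + lam * u x)) ≤ x ^ 5 * lam ^ 2 := by gcongr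
      linarith) hr.1
  simp at this
  linarith

lemma vbd (h : Zone2 lam ρ s u v) {r : ℝ} (hr : r ∈ Set.Icc ρ s) :
    (ρ * v ρ) * ρ ^ 4 / r ^ 5 ≤ v r ∧ v r ≤ lam ^ 2 * r := by
  have h0 := h.rpos
  have hr0 : 0 < r := h.rpos.trans_le hr.1
  have h5 : 0 < r ^ 5 := by positivity
  constructor
  · rw [div_le_iff₀ h5]
    linarith [h.Ylow hr]
  · have h1 := h.vup hr
    have h2 := h.X0
    have h3 := h.lam_pos
    have h4 : r ^ 5 * v r ≤ r ^ 5 * (lam ^ 2 * r) := by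
      have a1 : ρ ^ 5 * v ρ ≤ 0 := by nlinarith [pow_pos h0 4]
      have a2 : lam ^ 2 * (r ^ 5 * (r - ρ)) ≤ lam ^ 2 * (r ^ 5 * r) := by gcongr; linarith
      nlinarith
    exact le_of_mul_le_mul_left h4 h5

lemma uup (h : Zone2 lam ρ s u v) {r : ℝ} (hr : r ∈ Set.Icc ρ s) :
    u r ≤ (ρ * v ρ) / 4 * (1 - (ρ / r) ^ 4) + lam ^ 2 * (r - ρ) ^ 2 / 2 := by
  have := sub_le_sub_of_deriv (a := ρ) (b := r) (f := u) (f' := v)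
    (g := fun t => (ρ * v ρ) / 4 * (1 - (ρ / t) ^ 4) + lam ^ 2 / 2 * (t - ρ) ^ 2)
    (g' := fun x => (ρ * v ρ) * ρ ^ 4 / x ^ 5 + lam ^ 2 / 2 * (2 * (x - ρ)))
    (h.sol.cu.mono (h.sub hr)) ((h.cpsi r (ρ * v ρ)).add (by fun_prop))
    (fun x hx => h.sol.du x (h.mem hr hx))
    (fun x hx => (dpsi (h.mem hr hx).1 _).add (by
      refine hd_congr ((((hasDerivAt_id x).sub_const ρ).pow 2).const_mul (lam ^ 2 / 2))
        (fun s => rfl) ?_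
      simp))
    (fun x hx => by
      have h1 := h.vup (r := x) ⟨hx.1.le, hx.2.le.trans hr.2⟩
      have h2 := (h.mem hr hx).1
      have h5 : 0 < x ^ 5 := by positivity
      have e : (ρ * v ρ) * ρ ^ 4 / x ^ 5 + lam ^ 2 / 2 * (2 * (x - ρ)) =
        (ρ ^ 5 * v ρ + lam ^ 2 * (x ^ 5 * (x - ρ))) / x ^ 5 := by field_simp
      rw [e, le_div_iff₀ h5]
      linarith) hr.1
  have h0 := h.rpos
  rw [h.uz, div_self h0.ne'] at this
  norm_num at this
  linarith

lemma next (h : Zone2 lam ρ s u v) (hs : u s = 0) (hX : lam ≤ -(ρ * v ρ)) :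
    1 / (2 * lam) ≤ s ^ 2 := by
  have h1 := h.uup (r := s) ⟨h.rs.le, le_rfl⟩
  have h0 := h.rpos
  have hl := h.lam_pos
  have hs0 : 0 < s := h0.trans h.rs
  have h2 : (ρ / s) ^ 4 ≤ ρ / s := by
    apply pow_le_of_le_one (by positivity) _ (by norm_num)
    rw [div_le_one hs0]; exact h.rs.le
  rw [hs] at h1
  have h3 : lam / 4 * (1 - ρ / s) ≤ lam ^ 2 * (s - ρ) ^ 2 / 2 := by
    have : ρ / s ≤ 1 := by rw [div_le_one hs0]; exact h.rs.le
    nlinarith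
  have e : 1 - ρ / s = (s - ρ) / s := by field_simp
  rw [e] at h3
  have hsr : 0 < s - ρ := by linarith [h.rs]
  have h4 : (lam * (s - ρ) / 4) * 1 ≤ (lam * (s - ρ) / 4) * (2 * lam * (s - ρ) * s) := by
    have := mul_le_mul_of_nonneg_right h3 hs0.le
    calc _ = lam / 4 * ((s - ρ) / s) * s := by field_simp
      _ ≤ _ := this
      _ = _ := by ring
  have h5 := le_of_mul_le_mul_left h4 (by positivity)
  rw [div_le_iff₀ (by positivity)]
  have : 2 * lam * (s - ρ) * s ≤ 2 * lam * s * s := by gcongr; linarith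
  nlinarith

end Zone2

lemma BNSol.radSol {lam : ℝ} {m : ℕ} {u u' u'' : ℝ → ℝ} (h : BNSol 6 lam m u u' u'') :
    RadSol lam u u' where
  cu := fun r hr => (h.deriv_fst r hr).continuousWithinAt
  cv := fun r hr => (h.deriv_snd r hr).continuousWithinAt
  du := fun r hr => (h.deriv_fst r (Ioo_subset_Icc_self hr)).hasDerivAt (Icc_mem_nhds hr.1 hr.2)
  dv := fun r hr => by
    have h1 := (h.deriv_snd r (Ioo_subset_Icc_self hr)).hasDerivAt (Icc_mem_nhds hr.1 hr.2)
    have h2 := h.ode r hr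
    have e : (4:ℝ) / (((6:ℕ):ℝ) - 2) = 1 := by norm_num
    rw [e, Real.rpow_one] at h2
    have e2 : ((6:ℕ):ℝ) - 1 = 5 := by norm_num
    rw [e2] at h2
    have e3 : -(5 / r) * u' r - (|u r| * u r + lam * u r) = u'' r := by linarith
    rw [e3]; exact h1

lemma exists_zero_of_sign {a b : ℝ} {u : ℝ → ℝ} (hab : a ≤ b) (hc : ContinuousOn u (Set.Icc a b))
    (hs : (u a ≤ 0 ∧ 0 ≤ u b) ∨ (0 ≤ u a ∧ u b ≤ 0)) : ∃ c ∈ Set.Icc a b, u c = 0 := by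
  rcases hs with hs | hs
  · exact intermediate_value_Icc hab hc hs
  · exact intermediate_value_Icc' hab hc ⟨hs.2, hs.1⟩

lemma BNSol.zone1 {lam ρ : ℝ} {m : ℕ} {u u' u'' : ℝ → ℝ} (h : BNSol 6 lam m u u' u'') (hm : 2 ≤ m)
    (hl : 0 < lam) (hz : IsFirstZero u ρ) : Zone1 lam ρ u u' := by
  have hne : {r : ℝ | r ∈ Set.Ioo (0:ℝ) 1 ∧ u r = 0}.Nonempty := by
    apply Set.nonempty_of_ncard_ne_zero
    rw [h.nodal]; omega
  obtain ⟨c, hc, hc0⟩ := hne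
  obtain ⟨⟨hz1, hz2⟩, hz3, hz4⟩ := hz
  refine ⟨h.radSol, hl, hz1, ?_, h.bc_deriv_zero, ?_, hz3⟩
  · by_contra hcon
    push Not at hcon
    exact hz4 c ⟨hc.1, hc.2.trans_le hcon⟩ hc0
  · intro r hr
    rcases hr.1.eq_or_lt with h0 | h0
    · rw [← h0]; exact h.pos_zero
    by_contra hcon
    push Not at hcon
    obtain ⟨d, hd, hd0⟩ := exists_zero_of_sign hr.1 (h.radSol.cu.mono
      (Icc_subset_Icc_right (hr.2.le.trans hz2))) (Or.inr ⟨h.pos_zero.le, hcon⟩)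
    rcases hd.1.eq_or_lt with h1 | h1
    · rw [← h1] at hd0; linarith [h.pos_zero]
    · exact hz4 d ⟨h1, hd.2.trans_lt hr.2⟩ hd0

lemma BNSol.zone2 {lam ρ : ℝ} {m : ℕ} {u u' u'' : ℝ → ℝ} (h : BNSol 6 lam m u u' u'') (hm : 2 ≤ m)
    (hl : 0 < lam) (hz : IsFirstZero u ρ) (hX0 : 0 < -(ρ * u' ρ)) (hX2 : -(ρ * u' ρ) ≤ 2 * lam) :
    ∃ s, Zone2 lam ρ s u u' ∧ u s = 0 ∧ ∀ r ∈ Set.Ioo ρ s, u r < 0 := by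
  have hfin : {r : ℝ | r ∈ Set.Ioo (0:ℝ) 1 ∧ u r = 0}.Finite := by
    apply Set.finite_of_ncard_ne_zero
    rw [h.nodal]; omega
  have z1 := h.zone1 hm hl hz
  have hfin2 : {r : ℝ | r ∈ Set.Ioc ρ 1 ∧ u r = 0}.Finite := by
    apply (hfin.union (Set.finite_singleton 1)).subset
    rintro x ⟨hx, hx0⟩
    rcases hx.2.eq_or_lt with h1 | h1
    · right; exact h1
    · left; exact ⟨⟨z1.rpos.trans hx.1, h1⟩, hx0⟩
  obtain ⟨s, ⟨hs, hs0⟩, hmin⟩ := Set.exists_min_image _ id hfin2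
    ⟨1, ⟨z1.rle, le_rfl⟩, h.bc_one⟩
  have hneg : ∀ r ∈ Set.Ioo ρ s, u r < 0 := by
    intro r hr
    by_contra hcon
    push Not at hcon
    have hv : u' ρ < 0 := by
      by_contra hc
      push Not at hc
      have := mul_nonneg z1.rpos.le hc
      linarith
    have hd := h.radSol.du ρ ⟨z1.rpos, z1.rle⟩
    have h1 := (hasDerivAt_iff_tendsto_slope.1 hd).eventually (eventually_lt_nhds hv)
    have h2 : ∀ᶠ x in 𝓝[>] ρ, slope u ρ x < 0 :=
      h1.filter_mono (nhdsWithin_mono ρ (fun x hx => ne_of_gt hx))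
    obtain ⟨p, hp1, hp2⟩ := (h2.and (Ioo_mem_nhdsGT hr.1)).exists
    have hup : u p < 0 := by
      rw [slope_def_field, z1.uz, sub_zero] at hp1
      have : 0 < p - ρ := by linarith [hp2.1]
      by_contra hc
      push Not at hc
      have := div_nonneg hc this.le
      linarith
    obtain ⟨d, hd, hd0⟩ := exists_zero_of_sign hp2.2.le (h.radSol.cu.mono
      (Icc_subset_Icc (z1.rpos.trans hp2.1).le (hr.2.le.trans hs.2))) (Or.inl ⟨hup.le, hcon⟩)
    have := hmin d ⟨⟨hp2.1.trans_le hd.1, hd.2.trans (hr.2.le.trans hs.2)⟩, hd0⟩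
    simp only [id] at this
    linarith [hd.2, hr.2]
  refine ⟨s, ⟨h.radSol, hl, z1.rpos, hs.1, hs.2, z1.uz, ?_, hX0, hX2⟩, hs0, hneg⟩
  intro r hr
  rcases hr.1.eq_or_lt with h1 | h1
  · rw [← h1, z1.uz]
  rcases hr.2.eq_or_lt with h2 | h2
  · rw [h2, hs0]
  · exact (hneg r ⟨h1, h2⟩).le

/-- Summary of the local analysis for the sequence. -/
structure SeqData (lamBar : ℝ) (lam : ℕ → ℝ) (u v : ℕ → ℝ → ℝ) (ρ X : ℕ → ℝ) (d F : ℝ) : Prop where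
  lb_pos : 0 < lamBar
  hlam : Tendsto lam atTop (𝓝 lamBar)
  sol : ∀ n, RadSol (lam n) (u n) (v n)
  one : ∀ n, u n 1 = 0
  d0 : 0 < d
  d1 : d < 1
  F0 : 0 < F
  dF : F * d ^ 2 < lamBar / 2
  rpos : ∀ n, 0 < ρ n
  rz : ∀ n, u n (ρ n) = 0
  hr : Tendsto ρ atTop (𝓝 0)
  hX : Tendsto X atTop (𝓝 (2 * lamBar))
  bd : ∀ᶠ n in atTop, ∀ r ∈ Set.Ioc (ρ n) d, u n r < 0 ∧ -(X n / 4) ≤ u n r ∧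
    u n r ≤ -(X n / 4) * (1 - (ρ n / r) ^ 4) + F * r ^ 2 ∧
    -(X n) * ρ n ^ 4 / r ^ 5 ≤ v n r ∧ v n r ≤ F * r

lemma seqData {m : ℕ} (hm : 2 ≤ m) {lamBar : ℝ} (hlamBar : 0 < lamBar)
    {lam : ℕ → ℝ} (hlam : Tendsto lam atTop (𝓝 lamBar))
    {u u' u'' : ℕ → ℝ → ℝ} {r : ℕ → ℝ}
    (hsol : ∀ n, BNSol 6 (lam n) m (u n) (u' n) (u'' n))
    (hfz : ∀ n, IsFirstZero (u n) (r n))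
    (hblow : Tendsto (fun n => u n 0) atTop atTop) :
    ∃ d F, SeqData lamBar lam u u' r (fun n => -(r n * u' n (r n))) d F := by
  -- constants
  set L := lamBar + 1 with hL
  have hL0 : 0 < L := by positivity
  have e1 : ∀ᶠ n in atTop, lamBar / 2 < lam n := hlam.eventually (lt_mem_nhds (by linarith))
  have e2 : ∀ᶠ n in atTop, lam n < L := hlam.eventually (gt_mem_nhds (by linarith))
  have e3 : ∀ᶠ n in atTop, L ≤ u n 0 := hblow.eventually (eventually_ge_atTop L)
  have hmain : ∀ᶠ n in atTop, 0 < -(r n * u' n (r n)) ∧ -(r n * u' n (r n)) ≤ 2 * lam n ∧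
      2 * lam n - 512 * lam n ^ 2 * r n ^ 2 ≤ -(r n * u' n (r n)) ∧
      r n ^ 4 * (9 / 4 * lam n * u n 0) ≤ (2304 + 288 * lam n) ^ 2 := by
    filter_upwards [e1, e2, e3] with n h1 h2 h3
    exact ((hsol n).zone1 hm (by linarith) (hfz n)).main (by linarith)
  have hr4 : Tendsto (fun n => r n ^ 4) atTop (𝓝 0) := by
    have hb : Tendsto (fun n => ((2304 + 288 * L) ^ 2 / (9 / 8 * lamBar)) / u n 0) atTop (𝓝 0) :=
      hblow.const_div_atTop _
    refine squeeze_zero' (Eventually.of_forall fun n => by positivity) ?_ hb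
    filter_upwards [e1, e2, e3, hmain] with n h1 h2 h3 h4
    have h5 := h4.2.2.2
    have hu0 : 0 < u n 0 := by linarith
    rw [div_div, le_div_iff₀ (by positivity)]
    calc r n ^ 4 * (9 / 8 * lamBar * u n 0) ≤ r n ^ 4 * (9 / 4 * lam n * u n 0) := by
          have : 9 / 8 * lamBar * u n 0 ≤ 9 / 4 * lam n * u n 0 :=
            mul_le_mul_of_nonneg_right (by linarith) hu0.le
          gcongr
      _ ≤ _ := h5
      _ ≤ _ := by
        have : 0 < lam n := by linarith
        gcongr
  have hrp : ∀ n, 0 < r n := fun n => (hfz n).1.1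
  have hr0 : Tendsto r atTop (𝓝 0) := by
    have h1 := (hr4.sqrt).sqrt
    simp only [Real.sqrt_zero] at h1
    refine h1.congr (fun n => ?_)
    have : r n ^ 4 = (r n ^ 2) ^ 2 := by ring
    rw [this, Real.sqrt_sq (by positivity), Real.sqrt_sq (hrp n).le]
  have hX : Tendsto (fun n => -(r n * u' n (r n))) atTop (𝓝 (2 * lamBar)) := by
    have hlow : Tendsto (fun n => 2 * lam n - 512 * lam n ^ 2 * r n ^ 2) atTop (𝓝 (2 * lamBar)) := by
      have := (hlam.const_mul 2).sub (((hlam.pow 2).const_mul 512).mul (hr0.pow 2))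
      simpa using this
    refine tendsto_of_tendsto_of_tendsto_of_le_of_le' hlow (hlam.const_mul 2) ?_ ?_
    · filter_upwards [hmain] with n h using h.2.2.1
    · filter_upwards [hmain] with n h using h.2.1
  set d := min (1 / 2) (min (1 / (2 * L)) (lamBar / (4 * L ^ 2))) with hd
  have hd0 : 0 < d := by
    rw [hd]; refine lt_min (by norm_num) (lt_min (by positivity) (by positivity))
  have hd1 : d ≤ 1 / 2 := min_le_left _ _
  have hd2 : d ≤ 1 / (2 * L) := (min_le_right _ _).trans (min_le_left _ _)
  have hd3 : d ≤ lamBar / (4 * L ^ 2) := (min_le_right _ _).trans (min_le_right _ _)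
  have hdd : d ^ 2 < d := by nlinarith
  refine ⟨d, L ^ 2, ⟨hlamBar, hlam, fun n => (hsol n).radSol, fun n => (hsol n).bc_one, hd0,
    by linarith, by positivity, ?_, hrp, fun n => (hfz n).2.1, hr0, hX, ?_⟩⟩
  · calc L ^ 2 * d ^ 2 ≤ L ^ 2 * d := by gcongr
      _ ≤ L ^ 2 * (lamBar / (4 * L ^ 2)) := by gcongr
      _ = lamBar / 4 := by field_simp
      _ < lamBar / 2 := by linarith
  · have e5 : ∀ᶠ n in atTop, lam n ≤ -(r n * u' n (r n)) := by
      have : Tendsto (fun n => -(r n * u' n (r n)) - lam n) atTop (𝓝 (2 * lamBar - lamBar)) :=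
        hX.sub hlam
      filter_upwards [this.eventually (lt_mem_nhds (show (0:ℝ) < 2 * lamBar - lamBar by linarith))]
        with n hn
      linarith
    filter_upwards [e1, e2, e5, hmain] with n h1 h2 h5 h4
    have hl : 0 < lam n := by linarith
    obtain ⟨s, zs, hs0, hneg⟩ := (hsol n).zone2 hm hl (hfz n) h4.1 h4.2.1
    have hs := zs.next hs0 h5
    have hspos : 0 < s := zs.rpos.trans zs.rs
    have hds : d < s := by
      apply lt_of_pow_lt_pow_left₀ 2 hspos.le
      calc d ^ 2 < d := hdd
        _ ≤ 1 / (2 * L) := hd2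
        _ ≤ 1 / (2 * lam n) := by gcongr
        _ ≤ s ^ 2 := hs
    intro x hx
    have hx' : x ∈ Set.Icc (r n) s := ⟨hx.1.le, hx.2.trans hds.le⟩
    have hx0 : 0 < x := (hrp n).trans hx.1
    have a1 := zs.ulow' hx'
    have a2 := zs.uup hx'
    have a3 := zs.vbd hx'
    have hl2 : lam n ^ 2 ≤ L ^ 2 := by gcongr
    refine ⟨hneg x ⟨hx.1, hx.2.trans_lt hds⟩, ?_, ?_, ?_, ?_⟩
    · linarith
    · have b1 : (x - r n) ^ 2 ≤ x ^ 2 := by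
        have := hx.1
        have := hrp n
        gcongr
        · linarith
      have b2 : lam n ^ 2 * (x - r n) ^ 2 ≤ L ^ 2 * x ^ 2 := by gcongr
      have b3 : 0 ≤ L ^ 2 * x ^ 2 := by positivity
      have e : -(-(r n * u' n (r n)) / 4) = r n * u' n (r n) / 4 := by ring
      rw [e]
      linarith
    · simp only [neg_neg]; exact a3.1
    · exact a3.2.trans (by gcongr)

lemma abs_mul_self_sub {B x y : ℝ} (hx : |x| ≤ B) (hy : |y| ≤ B) :
    |(|x| * x - |y| * y)| ≤ 2 * B * |x - y| := by
  have e : |x| * x - |y| * y = |x| * (x - y) + (|x| - |y|) * y := by ring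
  rw [e]
  calc _ ≤ |(|x| * (x - y))| + |(|x| - |y|) * y| := abs_add_le _ _
    _ = |x| * |x - y| + |(|x| - |y|)| * |y| := by rw [abs_mul, abs_mul, abs_abs]
    _ ≤ B * |x - y| + |x - y| * B := by
      have := abs_abs_sub_abs_le x y
      gcongr
    _ = _ := by ring

lemma gron_alg {B L l1 l2 x y p q c : ℝ} (hB : 0 ≤ B) (hx : |x| ≤ B) (hy : |y| ≤ B)
    (hl : |l1| ≤ L) (hc : 0 ≤ c) :
    2 * (x - y) * (p - q) + 2 * (p - q) * ((-c * p - (|x| * x + l1 * x)) - (-c * q - (|y| * y + l2 * y)))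
      ≤ (2 * B + L + 2) * ((x - y) ^ 2 + (p - q) ^ 2) + B ^ 2 * (l1 - l2) ^ 2 := by
  have h1 := abs_mul_self_sub hx hy
  set g := |x| * x - |y| * y with hg
  have e : (-c * p - (|x| * x + l1 * x)) - (-c * q - (|y| * y + l2 * y)) =
    -c * (p - q) - g - l1 * (x - y) - (l1 - l2) * y := by rw [hg]; ring
  rw [e]
  have hL : 0 ≤ L := (abs_nonneg _).trans hl
  have a1 : -(2 * (p - q) * g) ≤ 2 * B * ((x - y) ^ 2 + (p - q) ^ 2) := by
    have : -((p - q) * g) ≤ |p - q| * |g| := by rw [← abs_mul]; exact neg_le_abs _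
    have h2 : |p - q| * |g| ≤ |p - q| * (2 * B * |x - y|) := by gcongr
    have h3 : 2 * (|p - q| * |x - y|) ≤ (x - y) ^ 2 + (p - q) ^ 2 := by
      rw [← sq_abs (x - y), ← sq_abs (p - q)]
      nlinarith [sq_nonneg (|p - q| - |x - y|)]
    nlinarith
  have a2 : -(2 * (p - q) * (l1 * (x - y))) ≤ L * ((x - y) ^ 2 + (p - q) ^ 2) := by
    have : -((p - q) * (l1 * (x - y))) ≤ |p - q| * (|l1| * |x - y|) := by
      rw [← abs_mul, ← abs_mul]; exact neg_le_abs _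
    have h2 : |p - q| * (|l1| * |x - y|) ≤ |p - q| * (L * |x - y|) := by gcongr
    have h3 : 2 * (|p - q| * |x - y|) ≤ (x - y) ^ 2 + (p - q) ^ 2 := by
      rw [← sq_abs (x - y), ← sq_abs (p - q)]
      nlinarith [sq_nonneg (|p - q| - |x - y|)]
    nlinarith
  have a3 : -(2 * (p - q) * ((l1 - l2) * y)) ≤ (p - q) ^ 2 + B ^ 2 * (l1 - l2) ^ 2 := by
    have h2 : y ^ 2 ≤ B ^ 2 := by rw [← sq_abs y]; gcongr
    have h3 : (l1 - l2) ^ 2 * y ^ 2 ≤ (l1 - l2) ^ 2 * B ^ 2 := by gcongr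
    nlinarith [sq_nonneg (p - q + (l1 - l2) * y)]
  have a4 : 0 ≤ c * (p - q) ^ 2 := by positivity
  nlinarith [sq_nonneg (x - y - (p - q)), sq_nonneg (x - y)]

lemma RadSol.gronwall {l1 l2 : ℝ} {u1 v1 u2 v2 : ℝ → ℝ} (h1 : RadSol l1 u1 v1) (h2 : RadSol l2 u2 v2)
    {a r B L : ℝ} (ha : 0 ≤ a) (har : a ≤ r) (hr : r ≤ 1) (hB : 0 ≤ B)
    (hb1 : ∀ x ∈ Set.Icc a 1, |u1 x| ≤ B) (hb2 : ∀ x ∈ Set.Icc a 1, |u2 x| ≤ B) (hl : |l1| ≤ L) :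
    (u1 r - u2 r) ^ 2 + (v1 r - v2 r) ^ 2 ≤ Real.exp (2 * B + L + 2) *
      ((u1 a - u2 a) ^ 2 + (v1 a - v2 a) ^ 2 + B ^ 2 * (l1 - l2) ^ 2) := by
  set K := 2 * B + L + 2 with hK
  have hL : 0 ≤ L := (abs_nonneg _).trans hl
  have hK0 : 0 ≤ K := by positivity
  have hsub : Set.Icc a r ⊆ Set.Icc 0 1 := Icc_subset_Icc ha hr
  have key := sub_le_sub_of_deriv (a := a) (b := r)
    (f := fun s => Real.exp (-K * s) * ((u1 s - u2 s) ^ 2 + (v1 s - v2 s) ^ 2))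
    (g := fun s => B ^ 2 * (l1 - l2) ^ 2 * s)
    (f' := fun s => Real.exp (-K * s) * ((2 * (u1 s - u2 s) * (v1 s - v2 s) + 2 * (v1 s - v2 s) *
      ((-(5 / s) * v1 s - (|u1 s| * u1 s + l1 * u1 s)) - (-(5 / s) * v2 s - (|u2 s| * u2 s + l2 * u2 s))))
      - K * ((u1 s - u2 s) ^ 2 + (v1 s - v2 s) ^ 2)))
    (g' := fun s => B ^ 2 * (l1 - l2) ^ 2 * 1)
    (by
      have c1 := h1.cu.mono hsub
      have c2 := h2.cu.mono hsub
      have c3 := h1.cv.mono hsub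
      have c4 := h2.cv.mono hsub
      fun_prop)
    (by fun_prop)
    (fun x hx => by
      have hx' : x ∈ Set.Ioo (0:ℝ) 1 := ⟨ha.trans_lt hx.1, hx.2.trans_le hr⟩
      have d1 := ((h1.du x hx').sub (h2.du x hx')).pow 2
      have d2 := ((h1.dv x hx').sub (h2.dv x hx')).pow 2
      have d3 := ((hasDerivAt_id x).const_mul (-K)).exp
      refine hd_congr (d3.mul (d1.add d2)) (fun s => rfl) ?_
      simp
      ring)
    (fun x hx => (hasDerivAt_id x).const_mul _)
    (fun x hx => by
      have hx' : x ∈ Set.Icc a 1 := ⟨hx.1.le, hx.2.le.trans hr⟩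
      have hx0 : 0 < x := ha.trans_lt hx.1
      have g := gron_alg (c := 5 / x) (p := v1 x) (q := v2 x) (l2 := l2) hB (hb1 x hx') (hb2 x hx') hl
        (by positivity)
      rw [← hK] at g
      have e0 : Real.exp (-K * x) ≤ 1 := by
        rw [Real.exp_le_one_iff]; nlinarith
      have e1 := Real.exp_pos (-K * x)
      set G := (2 * (u1 x - u2 x) * (v1 x - v2 x) + 2 * (v1 x - v2 x) *
        ((-(5 / x) * v1 x - (|u1 x| * u1 x + l1 * u1 x)) - (-(5 / x) * v2 x - (|u2 x| * u2 x + l2 * u2 x))))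
        - K * ((u1 x - u2 x) ^ 2 + (v1 x - v2 x) ^ 2)
      have hG : G ≤ B ^ 2 * (l1 - l2) ^ 2 := by linarith
      have hp : 0 ≤ B ^ 2 * (l1 - l2) ^ 2 := by positivity
      calc Real.exp (-K * x) * G ≤ Real.exp (-K * x) * (B ^ 2 * (l1 - l2) ^ 2) := by gcongr
        _ ≤ 1 * (B ^ 2 * (l1 - l2) ^ 2) := by gcongr
        _ = _ := by ring) har
  have e0 : Real.exp (-K * a) ≤ 1 := by
    rw [Real.exp_le_one_iff]; nlinarith
  have hDa : 0 ≤ (u1 a - u2 a) ^ 2 + (v1 a - v2 a) ^ 2 := by positivity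
  have hDr : 0 ≤ (u1 r - u2 r) ^ 2 + (v1 r - v2 r) ^ 2 := by positivity
  set Da := (u1 a - u2 a) ^ 2 + (v1 a - v2 a) ^ 2
  set Dr := (u1 r - u2 r) ^ 2 + (v1 r - v2 r) ^ 2
  have k1 : Real.exp (-K * r) * Dr ≤ Da + B ^ 2 * (l1 - l2) ^ 2 := by
    have hp : 0 ≤ B ^ 2 * (l1 - l2) ^ 2 := by positivity
    have q1 : Real.exp (-K * a) * Da ≤ 1 * Da := by gcongr
    have q2 : B ^ 2 * (l1 - l2) ^ 2 * r ≤ B ^ 2 * (l1 - l2) ^ 2 * 1 := by gcongr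
    have q3 : 0 ≤ B ^ 2 * (l1 - l2) ^ 2 * a := by positivity
    linarith
  calc Dr = Real.exp (K * r) * (Real.exp (-K * r) * Dr) := by
        rw [← mul_assoc, ← Real.exp_add]; simp
    _ ≤ Real.exp (K * r) * (Da + B ^ 2 * (l1 - l2) ^ 2) := by gcongr
    _ ≤ Real.exp K * (Da + B ^ 2 * (l1 - l2) ^ 2) := by
      gcongr
      nlinarith

lemma RadSol.bounded {l : ℝ} {u v : ℝ → ℝ} (h : RadSol l u v) :
    ∃ B, 0 ≤ B ∧ ∀ x ∈ Set.Icc (0:ℝ) 1, |u x| ≤ B := by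
  obtain ⟨B, hB⟩ := isCompact_Icc.exists_bound_of_continuousOn h.cu
  refine ⟨B, (norm_nonneg _).trans (hB 0 (by simp)), fun x hx => hB x hx⟩

/-- backward uniqueness -/
lemma RadSol.back {l : ℝ} {u v : ℝ → ℝ} (h : RadSol l u v) {a r : ℝ} (ha : 0 < a) (har : a ≤ r)
    (hr : r ≤ 1) (hu : u r = 0) (hv : v r = 0) : u a = 0 := by
  obtain ⟨B, hB0, hB⟩ := h.bounded
  have hsub : Set.Icc a r ⊆ Set.Icc 0 1 := Icc_subset_Icc ha.le hr
  set K := 1 + 10 / a + (B + |l|) with hK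
  have key := le_of_deriv_nonneg (a := a) (b := r)
    (f := fun s => Real.exp (K * s) * (u s ^ 2 + v s ^ 2))
    (f' := fun s => Real.exp (K * s) * ((2 * u s * v s + 2 * v s *
      (-(5 / s) * v s - (|u s| * u s + l * u s))) + K * (u s ^ 2 + v s ^ 2)))
    (by
      have c1 := h.cu.mono hsub
      have c3 := h.cv.mono hsub
      fun_prop)
    (fun x hx => by
      have hx' : x ∈ Set.Ioo (0:ℝ) 1 := ⟨ha.trans hx.1, hx.2.trans_le hr⟩
      have d1 := (h.du x hx').pow 2
      have d2 := (h.dv x hx').pow 2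
      have d3 := ((hasDerivAt_id x).const_mul K).exp
      refine hd_congr (d3.mul (d1.add d2)) (fun s => rfl) ?_
      simp
      ring)
    (fun x hx => by
      have hx0 : 0 < x := ha.trans hx.1
      have hb := hB x (hsub (Ioo_subset_Icc_self hx))
      apply mul_nonneg (Real.exp_pos _).le
      have h3 : 2 * (|u x| * |v x|) ≤ u x ^ 2 + v x ^ 2 := by
        rw [← sq_abs (u x), ← sq_abs (v x)]
        nlinarith [sq_nonneg (|u x| - |v x|)]
      have a1 : -(2 * u x * v x) ≤ u x ^ 2 + v x ^ 2 := by nlinarith [sq_nonneg (u x + v x)]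
      have a2 : 2 * v x * (|u x| * u x + l * u x) ≤ (B + |l|) * (u x ^ 2 + v x ^ 2) := by
        have : v x * ((|u x| + l) * u x) ≤ |v x| * ((B + |l|) * |u x|) := by
          calc _ ≤ |v x * ((|u x| + l) * u x)| := le_abs_self _
            _ = |v x| * (|(|u x| + l)| * |u x|) := by rw [abs_mul, abs_mul]
            _ ≤ |v x| * ((B + |l|) * |u x|) := by
              have : |(|u x| + l)| ≤ B + |l| := by
                refine (abs_add_le _ _).trans ?_
                rw [abs_abs]; linarith
              gcongr
        have hBl : 0 ≤ B + |l| := by positivity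
        nlinarith
      have a3 : 10 / x * v x ^ 2 ≤ 10 / a * (u x ^ 2 + v x ^ 2) := by
        have : 10 / x ≤ 10 / a := by have := hx.1.le; gcongr
        have h4 : v x ^ 2 ≤ u x ^ 2 + v x ^ 2 := by nlinarith [sq_nonneg (u x)]
        gcongr
      have e : 2 * u x * v x + 2 * v x * (-(5 / x) * v x - (|u x| * u x + l * u x)) =
        2 * u x * v x - 10 / x * v x ^ 2 - 2 * v x * (|u x| * u x + l * u x) := by ring
      rw [e, hK]
      linarith) le_rfl har le_rfl
  rw [hu, hv] at key
  norm_num at key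
  have hp := Real.exp_pos (K * a)
  have h1 : u a ^ 2 + v a ^ 2 ≤ 0 := by
    by_contra hc
    push Not at hc
    have := mul_pos hp hc
    linarith
  nlinarith [sq_nonneg (u a), sq_nonneg (v a)]

lemma RadSol.simple {l : ℝ} {u v : ℝ → ℝ} (h : RadSol l u v) (h0 : u 0 ≠ 0) {r : ℝ}
    (hr : r ∈ Set.Icc (0:ℝ) 1) (hu : u r = 0) : v r ≠ 0 := by
  intro hv
  rcases hr.1.eq_or_lt with h1 | h1
  · rw [← h1] at hu; exact h0 hu
  have ht : Tendsto u (𝓝[>] 0) (𝓝 (u 0)) := by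
    have h3 := (h.cu 0 (by simp)).mono_left (nhdsWithin_mono 0 (Ioo_subset_Icc_self (a := (0:ℝ)) (b := 1)))
    rwa [nhdsWithin_Ioo_eq_nhdsGT one_pos] at h3
  have ht2 : Tendsto u (𝓝[>] 0) (𝓝 0) := by
    refine tendsto_const_nhds.congr' ?_
    filter_upwards [Ioo_mem_nhdsGT h1] with x hx
    exact (h.back hx.1 hx.2.le hr.2 hu hv).symm
  exact h0 (tendsto_nhds_unique ht ht2)

lemma hasDeriv_abs_cube (x : ℝ) : HasDerivAt (fun y : ℝ => |y| ^ 3 / 3) (|x| * x) x := by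
  have h := (hasDerivAt_abs_rpow x (p := 3) (by norm_num)).div_const 3
  refine hd_congr h (fun s => ?_) ?_
  · norm_cast
  · norm_num
    ring

/-- the energy -/
noncomputable def En (l : ℝ) (u v : ℝ → ℝ) (r : ℝ) : ℝ := v r ^ 2 / 2 + |u r| ^ 3 / 3 + l * u r ^ 2 / 2

lemma RadSol.energy {l : ℝ} {u v : ℝ → ℝ} (h : RadSol l u v) {x y : ℝ} (hx : 0 ≤ x) (hxy : x ≤ y)
    (hy : y ≤ 1) : En l u v y ≤ En l u v x := by
  have := le_of_deriv_nonneg (a := 0) (b := 1) (f := fun r => - En l u v r)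
    (f' := fun r => 5 / r * v r ^ 2)
    (by
      have c1 := h.cu
      have c2 := h.cv
      unfold En
      fun_prop)
    (fun r hr => by
      have := ((((h.dv r hr).pow 2).div_const 2).add ((hasDeriv_abs_cube (u r)).comp r (h.du r hr))).add
        ((((h.du r hr).pow 2).const_mul l).div_const 2)
      refine hd_congr this.neg (fun s => rfl) ?_
      simp
      ring)
    (fun r hr => by have := hr.1; positivity) hx hxy hy
  linarith

/-- extension of the derivative to the right end point -/
lemma deriv_at_one {f f' : ℝ → ℝ} (hc : ContinuousOn f (Set.Icc (0:ℝ) 1))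
    (hd : ∀ r ∈ Set.Ioo (0:ℝ) 1, HasDerivAt f (f' r) r)
    (hc' : Tendsto f' (𝓝[<] 1) (𝓝 (f' 1))) : HasDerivWithinAt f (f' 1) (Set.Icc (0:ℝ) 1) 1 := by
  have h1 : HasDerivWithinAt f (f' 1) (Set.Iic 1) 1 := by
    apply hasDerivWithinAt_Iic_of_tendsto_deriv (s := Set.Ioo (0:ℝ) 1)
    · intro x hx; exact (hd x hx).differentiableAt.differentiableWithinAt
    · exact (hc 1 (by simp)).mono Ioo_subset_Icc_self
    · exact Ioo_mem_nhdsLT one_pos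
    · refine hc'.congr' ?_
      filter_upwards [Ioo_mem_nhdsLT one_pos] with x hx using (hd x hx).deriv.symm
  exact h1.mono (fun x hx => hx.2)

lemma deriv_at_zero {f f' : ℝ → ℝ} (hc : ContinuousOn f (Set.Icc (0:ℝ) 1))
    (hd : ∀ r ∈ Set.Ioo (0:ℝ) 1, HasDerivAt f (f' r) r)
    (hc' : Tendsto f' (𝓝[>] 0) (𝓝 (f' 0))) : HasDerivWithinAt f (f' 0) (Set.Icc (0:ℝ) 1) 0 := by
  have h1 : HasDerivWithinAt f (f' 0) (Set.Ici 0) 0 := by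
    apply hasDerivWithinAt_Ici_of_tendsto_deriv (s := Set.Ioo (0:ℝ) 1)
    · intro x hx; exact (hd x hx).differentiableAt.differentiableWithinAt
    · exact (hc 0 (by simp)).mono Ioo_subset_Icc_self
    · exact Ioo_mem_nhdsGT one_pos
    · refine hc'.congr' ?_
      filter_upwards [Ioo_mem_nhdsGT one_pos] with x hx using (hd x hx).deriv.symm
  exact h1.mono (fun x hx => hx.1)

lemma tendsto_at_one {f : ℝ → ℝ} (hc : ContinuousOn f (Set.Icc (0:ℝ) 1)) :
    Tendsto f (𝓝[<] 1) (𝓝 (f 1)) := by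
  have h3 := (hc 1 (by simp)).mono_left (nhdsWithin_mono 1 (Ioo_subset_Icc_self (a := (0:ℝ)) (b := 1)))
  rwa [nhdsWithin_Ioo_eq_nhdsLT one_pos] at h3

lemma tendsto_at_zero {f : ℝ → ℝ} (hc : ContinuousOn f (Set.Icc (0:ℝ) 1)) :
    Tendsto f (𝓝[>] 0) (𝓝 (f 0)) := by
  have h3 := (hc 0 (by simp)).mono_left (nhdsWithin_mono 0 (Ioo_subset_Icc_self (a := (0:ℝ)) (b := 1)))
  rwa [nhdsWithin_Ioo_eq_nhdsGT one_pos] at h3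

lemma RadSol.du_within {l : ℝ} {u v : ℝ → ℝ} (h : RadSol l u v) {r : ℝ} (hr : r ∈ Set.Icc (0:ℝ) 1) :
    HasDerivWithinAt u (v r) (Set.Icc (0:ℝ) 1) r := by
  rcases hr.1.eq_or_lt with h0 | h0
  · rw [← h0]; exact deriv_at_zero h.cu h.du (tendsto_at_zero h.cv)
  rcases hr.2.eq_or_lt with h1 | h1
  · rw [h1]; exact deriv_at_one h.cu h.du (tendsto_at_one h.cv)
  · exact (h.du r ⟨h0, h1⟩).hasDerivWithinAt

/-- the second derivative, including the value at the origin -/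
noncomputable def secondD (l : ℝ) (u v : ℝ → ℝ) (r : ℝ) : ℝ :=
  if r = 0 then -(|u 0| * u 0 + l * u 0) / 6 else -(5 / r) * v r - (|u r| * u r + l * u r)

lemma RadSol.dv_within {l : ℝ} {u v : ℝ → ℝ} (h : RadSol l u v) (hv0 : v 0 = 0) {r : ℝ}
    (hr : r ∈ Set.Icc (0:ℝ) 1) :
    HasDerivWithinAt v (secondD l u v r) (Set.Icc (0:ℝ) 1) r := by
  have hd : ∀ r ∈ Set.Ioo (0:ℝ) 1, HasDerivAt v (secondD l u v r) r := by
    intro r hr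
    rw [secondD, if_neg hr.1.ne']
    exact h.dv r hr
  rcases hr.1.eq_or_lt with h0 | h0
  · rw [← h0]
    have tu := tendsto_at_zero h.cu
    have tv := tendsto_at_zero h.cv
    rw [hv0] at tv
    have tid : Tendsto (fun x : ℝ => x) (𝓝[>] 0) (𝓝 0) := tendsto_id.mono_left nhdsWithin_le_nhds
    have hl := HasDerivAt.lhopital_zero_right_on_Ioo (l := 𝓝 (secondD l u v 0)) (a := 0) (b := 1)
      (f := fun s => s ^ 5 * v s)
      (f' := fun r => -(r ^ 5 * (|u r| * u r + l * u r))) (g := fun s => s ^ 6)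
      (g' := fun s => ((6:ℕ):ℝ) * s ^ 5) one_pos
      (fun x hx => h.dY hx) (fun x hx => hasDerivAt_pow 6 x)
      (fun x hx => by have := hx.1; positivity)
      (by simpa using (tid.pow 5).mul tv)
      (by simpa using tid.pow 6)
      (by
        have : Tendsto (fun r => -(|u r| * u r + l * u r) / 6) (𝓝[>] 0) (𝓝 (secondD l u v 0)) := by
          rw [secondD, if_pos rfl]
          exact (((tu.abs.mul tu).add (tu.const_mul l)).neg).div_const 6
        refine this.congr' ?_
        filter_upwards [self_mem_nhdsWithin] with x hx
        have hx0 : x ≠ 0 := ne_of_gt hx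
        field_simp
        push_cast
        ring)
    have h2 : HasDerivWithinAt v (secondD l u v 0) (Set.Ioi 0) 0 := by
      rw [hasDerivWithinAt_iff_tendsto_slope' (by simp)]
      refine hl.congr' ?_
      filter_upwards [self_mem_nhdsWithin] with x hx
      have hx0 : x ≠ 0 := ne_of_gt hx
      rw [slope_def_field, hv0]
      field_simp
      simp
      ring
    exact (hasDerivWithinAt_Ioi_iff_Ici.1 h2).mono (fun x hx => hx.1)
  rcases hr.2.eq_or_lt with h1 | h1
  · rw [h1]
    apply deriv_at_one h.cv hd
    have tu := tendsto_at_one h.cu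
    have tv := tendsto_at_one h.cv
    have tid : Tendsto (fun x : ℝ => x) (𝓝[<] 1) (𝓝 1) := tendsto_id.mono_left nhdsWithin_le_nhds
    have : Tendsto (fun r => -(5 / r) * v r - (|u r| * u r + l * u r)) (𝓝[<] 1)
        (𝓝 (secondD l u v 1)) := by
      rw [secondD, if_neg one_ne_zero]
      exact (((tendsto_const_nhds.div tid one_ne_zero).neg).mul tv).sub
        ((tu.abs.mul tu).add (tu.const_mul l))
    refine this.congr' ?_
    filter_upwards [Ioo_mem_nhdsLT one_pos] with x hx
    rw [secondD, if_neg hx.1.ne']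
  · exact (hd r ⟨h0, h1⟩).hasDerivWithinAt

lemma RadSol.finite_zeros {l : ℝ} {u v : ℝ → ℝ} (h : RadSol l u v) (h0 : u 0 ≠ 0) :
    {r : ℝ | r ∈ Set.Icc (0:ℝ) 1 ∧ u r = 0}.Finite := by
  by_contra hinf
  obtain ⟨p, hp, hacc⟩ := Set.Infinite.exists_accPt_of_subset_isCompact (K := Set.Icc (0:ℝ) 1)
    hinf isCompact_Icc (fun x hx => hx.1)
  rw [accPt_iff_frequently] at hacc
  have hup : u p = 0 := by
    by_contra hc
    have h1 := (h.cu p hp).eventually (isOpen_ne.mem_nhds hc)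
    rw [eventually_nhdsWithin_iff] at h1
    obtain ⟨y, hy1, hy2⟩ := (hacc.and_eventually h1).exists
    exact hy2 hy1.2.1 hy1.2.2
  have h2 := (h.du_within hp).eventually_ne (c := 0) (h.simple h0 hp hup)
  rw [eventually_nhdsWithin_iff] at h2
  obtain ⟨y, hy1, hy2⟩ := (hacc.and_eventually h2).exists
  exact hy2 ⟨hy1.2.1, hy1.1⟩ hy1.2.2

lemma RadSol.scale {l k : ℝ} {u v : ℝ → ℝ} (h : RadSol l u v) (hk : 0 < k) (hk1 : k ≤ 1) :
    RadSol (k ^ 2 * l) (fun r => k ^ 2 * u (k * r)) (fun r => k ^ 3 * v (k * r)) := by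
  have hmaps : Set.MapsTo (fun r => k * r) (Set.Icc (0:ℝ) 1) (Set.Icc (0:ℝ) 1) := by
    intro x hx
    exact ⟨mul_nonneg hk.le hx.1, by nlinarith [hx.1, hx.2]⟩
  have hd : ∀ r, HasDerivAt (fun r => k * r) k r := fun r => by
    simpa using (hasDerivAt_id r).const_mul k
  have hmem : ∀ r ∈ Set.Ioo (0:ℝ) 1, k * r ∈ Set.Ioo (0:ℝ) 1 := fun x hx =>
    ⟨mul_pos hk hx.1, by nlinarith [hx.1, hx.2]⟩
  refine ⟨?_, ?_, ?_, ?_⟩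
  · exact continuousOn_const.mul (h.cu.comp (by fun_prop) hmaps)
  · exact continuousOn_const.mul (h.cv.comp (by fun_prop) hmaps)
  · intro r hr
    refine hd_congr (((h.du (k * r) (hmem r hr)).comp r (hd r)).const_mul (k ^ 2)) (fun s => rfl) ?_
    ring
  · intro r hr
    have hr0 : r ≠ 0 := hr.1.ne'
    refine hd_congr (((h.dv (k * r) (hmem r hr)).comp r (hd r)).const_mul (k ^ 3)) (fun s => rfl) ?_
    rw [abs_mul, abs_of_pos (by positivity : 0 < k ^ 2)]
    field_simp

lemma OverdetSol.radSol {lam : ℝ} {m : ℕ} {u u' u'' : ℝ → ℝ} (h : OverdetSol lam m u u' u'') :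
    RadSol lam u u' where
  cu := fun r hr => (h.deriv_fst r hr).continuousWithinAt
  cv := fun r hr => (h.deriv_snd r hr).continuousWithinAt
  du := fun r hr => (h.deriv_fst r (Ioo_subset_Icc_self hr)).hasDerivAt (Icc_mem_nhds hr.1 hr.2)
  dv := fun r hr => by
    have h1 := (h.deriv_snd r (Ioo_subset_Icc_self hr)).hasDerivAt (Icc_mem_nhds hr.1 hr.2)
    have h2 := h.ode r hr
    have e3 : -(5 / r) * u' r - (|u r| * u r + lam * u r) = u'' r := by linarith
    rw [e3]; exact h1

lemma OverdetSol.not_lt {l1 l2 : ℝ} {m : ℕ} {u u' u'' w w' w'' : ℝ → ℝ}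
    (h1 : OverdetSol l1 m u u' u'') (h2 : OverdetSol l2 m w w' w'') : ¬ l1 < l2 := by
  intro hlt
  have p1 := h1.lam_pos
  have p2 := h2.lam_pos
  set k := Real.sqrt (l1 / l2) with hk
  have hk2 : k ^ 2 = l1 / l2 := Real.sq_sqrt (by positivity)
  have hk0 : 0 < k := Real.sqrt_pos.2 (by positivity)
  have hk1 : k < 1 := by
    rw [hk, Real.sqrt_lt' one_pos, one_pow, div_lt_one p2]; exact hlt
  have hs := h2.radSol.scale hk0 hk1.le
  have hl : k ^ 2 * l2 = l1 := by rw [hk2]; field_simp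
  rw [hl] at hs
  obtain ⟨B1, hB1, hb1⟩ := h1.radSol.bounded
  obtain ⟨B2, hB2, hb2⟩ := hs.bounded
  have heq : ∀ r ∈ Set.Icc (0:ℝ) 1, u r = k ^ 2 * w (k * r) := by
    intro r hr
    have g := h1.radSol.gronwall hs le_rfl hr.1 hr.2 (B := max B1 B2) (L := |l1|)
      (hB1.trans (le_max_left _ _)) (fun x hx => (hb1 x hx).trans (le_max_left _ _))
      (fun x hx => (hb2 x hx).trans (le_max_right _ _)) le_rfl
    have e0 : u 0 - k ^ 2 * w (k * 0) = 0 := by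
      rw [mul_zero, h1.val_zero, h2.val_zero, hk2]; field_simp; ring
    have e1 : u' 0 - k ^ 3 * w' (k * 0) = 0 := by
      rw [mul_zero, h1.bc_deriv_zero, h2.bc_deriv_zero]; ring
    simp only [e0, e1] at g
    norm_num at g
    have : (u r - k ^ 2 * w (k * r)) ^ 2 ≤ 0 := by
      nlinarith [sq_nonneg (u' r - k ^ 3 * w' (k * r))]
    have := pow_eq_zero_iff (two_ne_zero) |>.1 (le_antisymm this (sq_nonneg _))
    linarith
  have hwz : ∀ r ∈ Set.Icc (0:ℝ) 1, (u r = 0 ↔ w (k * r) = 0) := by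
    intro r hr
    rw [heq r hr]
    simp [hk0.ne']
  have hfin : {r : ℝ | r ∈ Set.Ioo (0:ℝ) 1 ∧ w r = 0}.Finite := by
    apply (h2.radSol.finite_zeros (by rw [h2.val_zero]; intro hc; linarith)).subset
    rintro x ⟨hx, hx0⟩
    exact ⟨Ioo_subset_Icc_self hx, hx0⟩
  have hss : (fun r => k * r) '' {r : ℝ | r ∈ Set.Ioo (0:ℝ) 1 ∧ u r = 0} ⊂
      {r : ℝ | r ∈ Set.Ioo (0:ℝ) 1 ∧ w r = 0} := by
    rw [Set.ssubset_iff_of_subset]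
    · refine ⟨k, ⟨⟨hk0, hk1⟩, ?_⟩, ?_⟩
      · have := (hwz 1 (by simp)).1 h1.bc_one
        rwa [mul_one] at this
      · rintro ⟨x, ⟨hx, -⟩, hx2⟩
        have h3 : k * x = k := hx2
        nlinarith [hx.2]
    · rintro _ ⟨x, ⟨hx, hx0⟩, rfl⟩
      exact ⟨⟨mul_pos hk0 hx.1, by nlinarith [hx.1, hx.2]⟩, (hwz x (Ioo_subset_Icc_self hx)).1 hx0⟩
  have hc := Set.ncard_lt_ncard hss hfin
  rw [Set.ncard_image_of_injective _ (mul_right_injective₀ hk0.ne'), h1.nodal, h2.nodal] at hc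
  exact lt_irrefl _ hc

section
variable {lamBar : ℝ} {lam : ℕ → ℝ} {u v : ℕ → ℝ → ℝ} {ρ X : ℕ → ℝ} {d F : ℝ}

lemma SeqData.near (h : SeqData lamBar lam u v ρ X d F) {δ η : ℝ} (hδ : 0 < δ) (hδd : δ ≤ d)
    (hη : 0 < η) : ∀ᶠ n in atTop, |u n δ + lamBar / 2| ≤ F * δ ^ 2 + η ∧ |v n δ| ≤ F * δ + η := by
  have hF := h.F0
  have t1 : Tendsto (fun n => -(X n / 4)) atTop (𝓝 (-(2 * lamBar / 4))) := (h.hX.div_const 4).neg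
  have t2 : Tendsto (fun n => -(X n / 4) * (1 - (ρ n / δ) ^ 4) + F * δ ^ 2) atTop
      (𝓝 (-(2 * lamBar / 4) * (1 - (0 / δ) ^ 4) + F * δ ^ 2)) :=
    (t1.mul (tendsto_const_nhds.sub ((h.hr.div_const δ).pow 4))).add tendsto_const_nhds
  have t3 : Tendsto (fun n => -(X n) * ρ n ^ 4 / δ ^ 5) atTop
      (𝓝 (-(2 * lamBar) * 0 ^ 4 / δ ^ 5)) :=
    (h.hX.neg.mul (h.hr.pow 4)).div_const _
  have e1 := t1.eventually (eventually_ge_nhds (b := -(lamBar / 2) - η) (by linarith))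
  have e2 := t2.eventually (eventually_le_nhds (b := -(lamBar / 2) + F * δ ^ 2 + η) (by simp; linarith))
  have e3 := t3.eventually (eventually_ge_nhds (b := - η) (by simp; linarith))
  have e4 := h.hr.eventually (eventually_lt_nhds hδ)
  filter_upwards [e1, e2, e3, e4, h.bd] with n f1 f2 f3 f4 f5
  obtain ⟨g1, g2, g3, g4, g5⟩ := f5 δ ⟨f4, hδd⟩
  have p1 : 0 < F * δ ^ 2 := by positivity
  have p2 : 0 < F * δ := by positivity
  constructor <;> rw [abs_le] <;> constructor <;> linarith

lemma SeqData.bound (h : SeqData lamBar lam u v ρ X d F) : ∃ B, 0 ≤ B ∧ ∀ δ, 0 < δ → δ ≤ d →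
    ∀ᶠ n in atTop, ∀ x ∈ Set.Icc δ 1, |u n x| ≤ B := by
  have hl := h.lb_pos
  have hF := h.F0
  set E := (F + 1) ^ 2 / 2 + (lamBar + 1) ^ 3 / 3 + (lamBar + 1) ^ 3 / 2 with hE
  have hE0 : 0 < E := by positivity
  refine ⟨4 * E / lamBar + 1, by positivity, ?_⟩
  intro δ hδ hδd
  have e1 := h.hlam.eventually (eventually_ge_nhds (b := lamBar / 2) (by linarith))
  have e2 := h.hlam.eventually (eventually_le_nhds (b := lamBar + 1) (by linarith))
  filter_upwards [h.near hδ hδd one_pos, h.near hδ hδd (half_pos one_pos), e1, e2] with n f1 f2 l1 l2 x hx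
  have hδ1 : δ < 1 := hδd.trans_lt h.d1
  have h1 : |u n δ| ≤ lamBar + 1 := by
    have : F * δ ^ 2 ≤ F * d ^ 2 := by gcongr
    have h2 := f2.1
    have := h.dF
    rw [abs_le] at h2 ⊢
    constructor <;> linarith
  have h2 : |v n δ| ≤ F + 1 := by nlinarith [f1.2]
  have hen := (h.sol n).energy hδ.le hx.1 hx.2
  have hE1 : En (lam n) (u n) (v n) δ ≤ E := by
    have a1 : v n δ ^ 2 ≤ (F + 1) ^ 2 := by rw [← sq_abs]; gcongr
    have a2 : |u n δ| ^ 3 ≤ (lamBar + 1) ^ 3 := by gcongr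
    have a3 : u n δ ^ 2 ≤ (lamBar + 1) ^ 2 := by rw [← sq_abs]; gcongr
    have a4 : lam n * u n δ ^ 2 ≤ (lamBar + 1) * (lamBar + 1) ^ 2 := by gcongr
    unfold En
    rw [hE]
    nlinarith
  have hE2 : lamBar / 4 * u n x ^ 2 ≤ En (lam n) (u n) (v n) x := by
    unfold En
    have : lamBar / 2 * u n x ^ 2 ≤ lam n * u n x ^ 2 := by gcongr
    have : 0 ≤ |u n x| ^ 3 := by positivity
    nlinarith [sq_nonneg (v n x)]
  have h3 : u n x ^ 2 ≤ 4 * E / lamBar := by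
    rw [le_div_iff₀ hl]; nlinarith
  rw [← sq_abs] at h3
  nlinarith [sq_nonneg (|u n x| - 1), abs_nonneg (u n x)]

lemma SeqData.cauchy (h : SeqData lamBar lam u v ρ X d F) {a ε : ℝ} (ha : 0 < a) (hε : 0 < ε) :
    ∃ N, ∀ m ≥ N, ∀ n ≥ N, ∀ x ∈ Set.Icc a 1, |u m x - u n x| < ε ∧ |v m x - v n x| < ε := by
  obtain ⟨B, hB, hbd⟩ := h.bound
  have hl := h.lb_pos
  have hF := h.F0
  set K := 2 * B + (lamBar + 1) + 2 with hK
  set C := Real.exp K * (32 + B ^ 2) with hC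
  have hC0 : 0 < C := by positivity
  set η := ε / (C + 1) with hη
  have hη0 : 0 < η := by positivity
  have hηC : C * η ^ 2 < ε ^ 2 := by
    have : η * (C + 1) = ε := by rw [hη]; field_simp
    rw [← this]
    nlinarith [sq_nonneg (η * C), pow_pos hη0 2, mul_pos hC0 (pow_pos hη0 2)]
  set δ := min (min a d) (η / F) with hδ
  have hd0 := h.d0
  have hδ0 : 0 < δ := by positivity
  have hδa : δ ≤ a := (min_le_left _ _).trans (min_le_left _ _)
  have hδd : δ ≤ d := (min_le_left _ _).trans (min_le_right _ _)
  have hδF : F * δ ≤ η := by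
    have : δ ≤ η / F := min_le_right _ _
    rw [le_div_iff₀ hF] at this; linarith
  have hδ1 : δ < 1 := hδd.trans_lt h.d1
  have hδF2 : F * δ ^ 2 ≤ η := by nlinarith
  have e1 := h.hlam.eventually (Metric.ball_mem_nhds lamBar (half_pos hη0))
  have e2 := h.hlam.eventually (Metric.ball_mem_nhds lamBar one_pos)
  obtain ⟨N, hN⟩ := eventually_atTop.1 (((h.near hδ0 hδd hη0).and (hbd δ hδ0 hδd)).and (e1.and e2))
  refine ⟨N, fun m hm n hn x hx => ?_⟩
  obtain ⟨⟨⟨m1, m2⟩, m3⟩, m4, m5⟩ := hN m hm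
  obtain ⟨⟨⟨n1, n2⟩, n3⟩, n4, n5⟩ := hN n hn
  rw [Real.dist_eq] at m4 n4 m5 n5
  have hlm : |lam m| ≤ lamBar + 1 := by
    rw [abs_lt] at m5; rw [abs_le]; constructor <;> linarith
  have hg := (h.sol m).gronwall (h.sol n) hδ0.le (hδa.trans hx.1) hx.2 hB m3 n3 hlm
  have b1 : (u m δ - u n δ) ^ 2 ≤ (4 * η) ^ 2 := by
    apply sq_le_sq'
    · rw [abs_le] at m1 n1; linarith
    · rw [abs_le] at m1 n1; linarith
  have b2 : (v m δ - v n δ) ^ 2 ≤ (4 * η) ^ 2 := by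
    apply sq_le_sq'
    · rw [abs_le] at m2 n2; linarith
    · rw [abs_le] at m2 n2; linarith
  have b3 : (lam m - lam n) ^ 2 ≤ η ^ 2 := by
    apply sq_le_sq'
    · rw [abs_lt] at m4 n4; linarith
    · rw [abs_lt] at m4 n4; linarith
  have hfin : (u m x - u n x) ^ 2 + (v m x - v n x) ^ 2 < ε ^ 2 := by
    refine lt_of_le_of_lt hg (lt_of_le_of_lt ?_ hηC)
    rw [hC, mul_assoc]
    apply mul_le_mul_of_nonneg_left _ (Real.exp_pos _).le
    have : B ^ 2 * (lam m - lam n) ^ 2 ≤ B ^ 2 * η ^ 2 := by gcongr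
    linarith
  constructor
  · apply abs_lt_of_sq_lt_sq _ hε.le
    nlinarith [sq_nonneg (v m x - v n x)]
  · apply abs_lt_of_sq_lt_sq _ hε.le
    nlinarith [sq_nonneg (u m x - u n x)]

/-- The limit function, its uniform convergence and its behaviour at the origin. -/
lemma SeqData.limit (h : SeqData lamBar lam u v ρ X d F) : ∃ w w1 : ℝ → ℝ,
    (∀ a, 0 < a → TendstoUniformlyOn u w atTop (Set.Icc a 1) ∧
      TendstoUniformlyOn v w1 atTop (Set.Icc a 1)) ∧ w 0 = -lamBar / 2 ∧ w1 0 = 0 ∧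
    ∀ δ ∈ Set.Icc 0 d, |w δ + lamBar / 2| ≤ F * δ ^ 2 ∧ |w1 δ| ≤ F * δ := by
  have hcu : ∀ a, 0 < a → UniformCauchySeqOn u atTop (Set.Icc a 1) := by
    intro a ha
    rw [Metric.uniformCauchySeqOn_iff]
    intro ε hε
    obtain ⟨N, hN⟩ := h.cauchy ha hε
    exact ⟨N, fun m hm n hn x hx => by rw [Real.dist_eq]; exact (hN m hm n hn x hx).1⟩
  have hcv : ∀ a, 0 < a → UniformCauchySeqOn v atTop (Set.Icc a 1) := by
    intro a ha
    rw [Metric.uniformCauchySeqOn_iff]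
    intro ε hε
    obtain ⟨N, hN⟩ := h.cauchy ha hε
    exact ⟨N, fun m hm n hn x hx => by rw [Real.dist_eq]; exact (hN m hm n hn x hx).2⟩
  have lu : ∀ x : ℝ, ∃ y, (x = 0 → y = -lamBar / 2) ∧
      (x ∈ Set.Ioc (0:ℝ) 1 → Tendsto (fun n => u n x) atTop (𝓝 y)) := by
    intro x
    by_cases hx : x ∈ Set.Ioc (0:ℝ) 1
    · obtain ⟨y, hy⟩ := cauchySeq_tendsto_of_complete ((hcu x hx.1).cauchySeq (x := x) ⟨le_rfl, hx.2⟩)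
      exact ⟨y, fun h0 => absurd h0 hx.1.ne', fun _ => hy⟩
    · exact ⟨_, fun _ => rfl, fun h0 => absurd h0 hx⟩
  have lv : ∀ x : ℝ, ∃ y, (x = 0 → y = 0) ∧
      (x ∈ Set.Ioc (0:ℝ) 1 → Tendsto (fun n => v n x) atTop (𝓝 y)) := by
    intro x
    by_cases hx : x ∈ Set.Ioc (0:ℝ) 1
    · obtain ⟨y, hy⟩ := cauchySeq_tendsto_of_complete ((hcv x hx.1).cauchySeq (x := x) ⟨le_rfl, hx.2⟩)
      exact ⟨y, fun h0 => absurd h0 hx.1.ne', fun _ => hy⟩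
    · exact ⟨_, fun _ => rfl, fun h0 => absurd h0 hx⟩
  choose w hw0 hw using lu
  choose w1 hw10 hw1 using lv
  refine ⟨w, w1, ?_, hw0 0 rfl, hw10 0 rfl, ?_⟩
  · intro a ha
    exact ⟨(hcu a ha).tendstoUniformlyOn_of_tendsto (fun x hx => hw x ⟨ha.trans_le hx.1, hx.2⟩),
      (hcv a ha).tendstoUniformlyOn_of_tendsto (fun x hx => hw1 x ⟨ha.trans_le hx.1, hx.2⟩)⟩
  · intro δ hδ
    rcases hδ.1.eq_or_lt with h0 | h0
    · rw [← h0, hw0 0 rfl, hw10 0 rfl]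
      constructor
      · ring_nf; simp
      · simp
    have hmem : δ ∈ Set.Ioc (0:ℝ) 1 := ⟨h0, hδ.2.trans h.d1.le⟩
    constructor
    · apply le_of_forall_pos_le_add
      intro η hη
      exact le_of_tendsto ((hw δ hmem).add_const (lamBar / 2)).abs
        ((h.near h0 hδ.2 hη).mono fun n hn => hn.1)
    · apply le_of_forall_pos_le_add
      intro η hη
      exact le_of_tendsto (hw1 δ hmem).abs ((h.near h0 hδ.2 hη).mono fun n hn => hn.2)
end

section
variable {lamBar : ℝ} {lam : ℕ → ℝ} {u v : ℕ → ℝ → ℝ} {ρ X : ℕ → ℝ} {d F : ℝ}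

lemma SeqData.limit_radSol (h : SeqData lamBar lam u v ρ X d F) {w w1 : ℝ → ℝ}
    (hU : ∀ a, 0 < a → TendstoUniformlyOn u w atTop (Set.Icc a 1) ∧
      TendstoUniformlyOn v w1 atTop (Set.Icc a 1)) (hw0 : w 0 = -lamBar / 2) (hw10 : w1 0 = 0)
    (hn : ∀ δ ∈ Set.Icc 0 d, |w δ + lamBar / 2| ≤ F * δ ^ 2 ∧ |w1 δ| ≤ F * δ) :
    RadSol lamBar w w1 := by
  have hl := h.lb_pos
  have cu : ∀ a, 0 < a → ContinuousOn w (Set.Icc a 1) := fun a ha =>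
    (hU a ha).1.continuousOn (Eventually.of_forall fun n =>
      (h.sol n).cu.mono (Icc_subset_Icc_left ha.le)).frequently
  have cv : ∀ a, 0 < a → ContinuousOn w1 (Set.Icc a 1) := fun a ha =>
    (hU a ha).2.continuousOn (Eventually.of_forall fun n =>
      (h.sol n).cv.mono (Icc_subset_Icc_left ha.le)).frequently
  have hnear : ∀ᶠ x in 𝓝[Set.Icc (0:ℝ) 1] 0, x ∈ Set.Icc 0 d := by
    filter_upwards [self_mem_nhdsWithin, mem_nhdsWithin_of_mem_nhds (Iio_mem_nhds h.d0)] with x h1 h2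
    exact ⟨h1.1, h2.le⟩
  have tid : Tendsto (fun x : ℝ => x) (𝓝[Set.Icc (0:ℝ) 1] 0) (𝓝 0) :=
    tendsto_id.mono_left nhdsWithin_le_nhds
  have ext : ∀ f : ℝ → ℝ, (∀ a, 0 < a → ContinuousOn f (Set.Icc a 1)) →
      ContinuousWithinAt f (Set.Icc (0:ℝ) 1) 0 → ContinuousOn f (Set.Icc (0:ℝ) 1) := by
    intro f hf h0 x hx
    rcases hx.1.eq_or_lt with h1 | h1
    · rw [← h1]; exact h0
    · refine (hf (x / 2) (by linarith) x ⟨by linarith, hx.2⟩).mono_of_mem_nhdsWithin ?_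
      filter_upwards [self_mem_nhdsWithin,
        mem_nhdsWithin_of_mem_nhds (Ioi_mem_nhds (show x / 2 < x by linarith))] with y h2 h3
      exact ⟨h3.le, h2.2⟩
  have CU : ContinuousOn w (Set.Icc (0:ℝ) 1) := by
    apply ext w cu
    have : Tendsto (fun x => w x + lamBar / 2) (𝓝[Set.Icc (0:ℝ) 1] 0) (𝓝 0) := by
      apply squeeze_zero_norm' (a := fun x => F * x ^ 2)
      · exact hnear.mono fun x hx => (hn x hx).1
      · simpa using (tid.pow 2).const_mul F
    have h2 := this.sub_const (lamBar / 2)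
    unfold ContinuousWithinAt
    rw [hw0]
    convert h2 using 1
    · ext x; ring
    · congr 1; ring
  have CV : ContinuousOn w1 (Set.Icc (0:ℝ) 1) := by
    apply ext w1 cv
    unfold ContinuousWithinAt
    rw [hw10]
    apply squeeze_zero_norm' (a := fun x => F * x)
    · exact hnear.mono fun x hx => (hn x hx).2
    · simpa using tid.const_mul F
  refine ⟨CU, CV, ?_, ?_⟩
  · intro r hr
    have hs : Set.Ioo (r / 2) 1 ⊆ Set.Icc (r / 2) 1 := Ioo_subset_Icc_self
    have hr2 : 0 < r / 2 := by linarith [hr.1]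
    exact hasDerivAt_of_tendstoUniformlyOn (isOpen_Ioo (a := r / 2) (b := 1))
      ((hU _ hr2).2.mono hs)
      (Eventually.of_forall fun n x hx => (h.sol n).du x ⟨hr2.trans hx.1, hx.2⟩)
      (fun x hx => (hU _ hr2).1.tendsto_at (hs hx)) ⟨by linarith [hr.1], hr.2⟩
  · intro r hr
    have hs : Set.Ioo (r / 2) 1 ⊆ Set.Icc (r / 2) 1 := Ioo_subset_Icc_self
    have hr2 : 0 < r / 2 := by linarith [hr.1]
    refine hasDerivAt_of_tendstoUniformlyOn (isOpen_Ioo (a := r / 2) (b := 1)) (l := atTop)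
      (f := v) (g := w1) (g' := fun r => -(5 / r) * w1 r - (|w r| * w r + lamBar * w r))
      (f' := fun n r => -(5 / r) * v n r - (|u n r| * u n r + lam n * u n r)) ?_
      (Eventually.of_forall fun n x hx => (h.sol n).dv x ⟨hr2.trans hx.1, hx.2⟩)
      (fun x hx => (hU _ hr2).2.tendsto_at (hs hx)) ⟨by linarith [hr.1], hr.2⟩
    obtain ⟨B0, hB0⟩ := isCompact_Icc.exists_bound_of_continuousOn CU
    set B := |B0| + 1 with hB
    have hBp : 0 < B := by positivity
    rw [Metric.tendstoUniformlyOn_iff]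
    intro ε hε
    set C := 5 / (r / 2) + 2 * B + B + lamBar with hC
    have hC0 : 0 < C := by positivity
    set κ := min 1 (ε / (C + 1)) with hκ
    have hκ0 : 0 < κ := by positivity
    have hκC : C * κ < ε := by
      have h1 : κ ≤ ε / (C + 1) := min_le_right _ _
      rw [le_div_iff₀ (by positivity)] at h1
      nlinarith
    have e1 := (Metric.tendstoUniformlyOn_iff.1 (hU _ hr2).1) κ hκ0
    have e2 := (Metric.tendstoUniformlyOn_iff.1 (hU _ hr2).2) κ hκ0
    have e3 := h.hlam.eventually (Metric.ball_mem_nhds lamBar hκ0)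
    filter_upwards [e1, e2, e3] with n f1 f2 f3 x hx
    replace f1 := f1 x (hs hx)
    replace f2 := f2 x (hs hx)
    rw [Real.dist_eq] at f1 f2 f3 ⊢
    have hx0 : 0 < x := hr2.trans hx.1
    have b1 : |w x| ≤ B := by
      have := hB0 x ⟨hx0.le, hx.2.le⟩
      rw [Real.norm_eq_abs] at this
      linarith [le_abs_self B0]
    have b2 : |u n x| ≤ B := by
      have := hB0 x ⟨hx0.le, hx.2.le⟩
      rw [Real.norm_eq_abs] at this
      have h3 : κ ≤ 1 := min_le_left _ _
      have h4 : |u n x| - |w x| ≤ |w x - u n x| := by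
        rw [abs_sub_comm]; exact abs_sub_abs_le_abs_sub _ _
      linarith [le_abs_self B0]
    have k1 := abs_mul_self_sub b1 b2
    have k2 : |5 / x * (w1 x - v n x)| ≤ 5 / (r / 2) * κ := by
      rw [abs_mul, abs_of_pos (by positivity : 0 < 5 / x)]
      have := hx.1.le
      gcongr
    have k3 : |(lam n - lamBar) * u n x| ≤ B * κ := by
      rw [abs_mul, mul_comm]; gcongr
    have k4 : |lamBar * (w x - u n x)| ≤ lamBar * κ := by
      rw [abs_mul, abs_of_pos hl]; gcongr
    have k1' : |(|w x| * w x - |u n x| * u n x)| ≤ 2 * B * κ := by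
      refine k1.trans ?_
      gcongr
    have : -(5 / x) * w1 x - (|w x| * w x + lamBar * w x) -
        (-(5 / x) * v n x - (|u n x| * u n x + lam n * u n x)) =
        -(5 / x * (w1 x - v n x)) - (|w x| * w x - |u n x| * u n x) + (lam n - lamBar) * u n x
          - lamBar * (w x - u n x) := by ring
    rw [this]
    refine lt_of_le_of_lt ?_ hκC
    rw [hC]
    rw [abs_le] at k1' k2 k3 k4 ⊢
    constructor <;> nlinarith
end

/-- Stability of the number of zeros (all simple) under `C¹` convergence. -/
lemma count_zeros {a : ℝ} {w w1 : ℝ → ℝ} {u v : ℕ → ℝ → ℝ}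
    (cw : ContinuousOn w (Set.Icc a 1)) (cw1 : ContinuousOn w1 (Set.Icc a 1))
    (dw : ∀ x ∈ Set.Ioo a 1, HasDerivAt w (w1 x) x) (wa : w a ≠ 0) (wone : w 1 = 0)
    (hsimple : ∀ p ∈ Set.Icc a 1, w p = 0 → w1 p ≠ 0)
    (hfin : {r | r ∈ Set.Icc a 1 ∧ w r = 0}.Finite)
    (cu : ∀ n, ContinuousOn (u n) (Set.Icc a 1))
    (du : ∀ n, ∀ x ∈ Set.Ioo a 1, HasDerivAt (u n) (v n x) x) (uone : ∀ n, u n 1 = 0)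
    (hU : TendstoUniformlyOn u w atTop (Set.Icc a 1))
    (hV : TendstoUniformlyOn v w1 atTop (Set.Icc a 1)) :
    ∀ᶠ n in atTop, {r | r ∈ Set.Icc a 1 ∧ w r = 0}.ncard = {r | r ∈ Set.Icc a 1 ∧ u n r = 0}.ncard := by
  set Z := {r | r ∈ Set.Icc a 1 ∧ w r = 0} with hZ
  have hZa : ∀ p ∈ Z, a < p := fun p hp =>
    lt_of_le_of_ne hp.1.1 (fun h => wa (by rw [h]; exact hp.2))
  have tid : Tendsto (fun s : ℝ => s) (𝓝[>] 0) (𝓝 0) := tendsto_id.mono_left nhdsWithin_le_nhds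
  -- choice of the radius
  have s1 : ∀ᶠ s in 𝓝[>] (0:ℝ), ∀ p ∈ Z, ∀ q ∈ Z, p ≠ q → 2 * s < |p - q| := by
    refine (eventually_all_finite hfin).2 fun p hp => (eventually_all_finite hfin).2 fun q hq => ?_
    by_cases hpq : p = q
    · exact Eventually.of_forall fun s h => absurd hpq h
    · have h0 : 0 < |p - q| := abs_pos.2 (sub_ne_zero.2 hpq)
      filter_upwards [tid.eventually (eventually_lt_nhds (half_pos h0))] with s hs _
      linarith
  have s2 : ∀ᶠ s in 𝓝[>] (0:ℝ), ∀ p ∈ Z, ∀ x ∈ Set.Icc a 1, |x - p| ≤ s →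
      w1 p ^ 2 / 2 < w1 x * w1 p := by
    refine (eventually_all_finite hfin).2 fun p hp => ?_
    have hp1 := hsimple p hp.1 hp.2
    have hpos : 0 < w1 p ^ 2 := by positivity
    have hc : ContinuousWithinAt (fun x => w1 x * w1 p) (Set.Icc a 1) p :=
      (cw1 p hp.1).mul continuousWithinAt_const
    have h1 := hc.eventually (eventually_gt_nhds (b := w1 p ^ 2 / 2) (by nlinarith))
    rw [Metric.nhdsWithin_basis_ball.eventually_iff] at h1
    obtain ⟨t, ht, h2⟩ := h1
    filter_upwards [tid.eventually (eventually_lt_nhds ht)] with s hs x hx hxs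
    apply h2
    exact ⟨by rw [Metric.mem_ball, Real.dist_eq]; linarith, hx⟩
  have s3 : ∀ᶠ s in 𝓝[>] (0:ℝ), ∀ p ∈ Z, a < p - s ∧ (p ≠ 1 → p + s < 1) := by
    refine (eventually_all_finite hfin).2 fun p hp => ?_
    have e1 := tid.eventually (eventually_lt_nhds (sub_pos.2 (hZa p hp)))
    by_cases h1 : p = 1
    · filter_upwards [e1] with s hs
      exact ⟨by linarith, fun h => absurd h1 h⟩
    · have : p < 1 := lt_of_le_of_ne hp.1.2 h1
      filter_upwards [e1, tid.eventually (eventually_lt_nhds (sub_pos.2 this))] with s hs hs2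
      exact ⟨by linarith, fun _ => by linarith⟩
  obtain ⟨s, ⟨⟨hs1, hs2⟩, hs3⟩, hs0⟩ := (((s1.and s2).and s3).and self_mem_nhdsWithin).exists
  replace hs0 : 0 < s := hs0
  -- away from the zeros
  have hK : IsCompact (Set.Icc a 1 \ ⋃ p ∈ Z, Metric.ball p s) :=
    isCompact_Icc.diff (isOpen_biUnion fun p _ => Metric.isOpen_ball)
  have hc : ∃ c > 0, ∀ x ∈ Set.Icc a 1 \ ⋃ p ∈ Z, Metric.ball p s, c ≤ |w x| := by
    rcases (Set.Icc a 1 \ ⋃ p ∈ Z, Metric.ball p s).eq_empty_or_nonempty with he | hne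
    · exact ⟨1, one_pos, fun x hx => by rw [he] at hx; exact absurd hx (by simp)⟩
    obtain ⟨x0, hx0, hmin⟩ := hK.exists_isMinOn hne ((cw.mono sdiff_subset).abs)
    refine ⟨|w x0|, ?_, fun x hx => hmin hx⟩
    apply abs_pos.2
    intro h0
    apply hx0.2
    simp only [Set.mem_iUnion]
    exact ⟨x0, ⟨hx0.1, h0⟩, Metric.mem_ball_self hs0⟩
  obtain ⟨c, hc0, hc⟩ := hc
  have n1 := Metric.tendstoUniformlyOn_iff.1 hU c hc0
  have n2 : ∀ᶠ n in atTop, ∀ p ∈ Z, ∀ x ∈ Set.Icc a 1, |x - p| ≤ s → 0 < v n x * w1 p := by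
    refine (eventually_all_finite hfin).2 fun p hp => ?_
    have hp1 : 0 < |w1 p| := abs_pos.2 (hsimple p hp.1 hp.2)
    filter_upwards [Metric.tendstoUniformlyOn_iff.1 hV (|w1 p| / 2) (by positivity)] with n hn x hx hxs
    have h1 := hs2 p hp x hx hxs
    have h2 := hn x hx
    rw [Real.dist_eq] at h2
    have h3 : |(w1 x - v n x) * w1 p| ≤ w1 p ^ 2 / 2 := by
      rw [abs_mul, ← sq_abs (w1 p)]; nlinarith
    have h4 := (abs_le.1 h3).2
    nlinarith
  have mvt : ∀ f f' : ℝ → ℝ, ContinuousOn f (Set.Icc a 1) → (∀ x ∈ Set.Ioo a 1, HasDerivAt f (f' x) x) →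
      ∀ x y, a ≤ x → x < y → y ≤ 1 → ∃ ξ ∈ Set.Ioo x y, f y - f x = f' ξ * (y - x) := by
    intro f f' hcf hdf x y hax hxy hy
    obtain ⟨ξ, hξ, h1⟩ := exists_hasDerivAt_eq_slope f f' hxy (hcf.mono (Icc_subset_Icc hax hy))
      (fun z hz => hdf z ⟨hax.trans_lt hz.1, hz.2.trans_le hy⟩)
    refine ⟨ξ, hξ, ?_⟩
    rw [h1]
    have : y - x ≠ 0 := by linarith
    field_simp
  have n3 : ∀ᶠ n in atTop, ∀ p ∈ Z, p ≠ 1 → u n (p - s / 2) * w1 p < 0 ∧ 0 < u n (p + s / 2) * w1 p := by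
    refine (eventually_all_finite hfin).2 fun p hp => ?_
    by_cases hp1 : p = 1
    · exact Eventually.of_forall fun n h => absurd hp1 h
    obtain ⟨k1, k2⟩ := hs3 p hp
    replace k2 := k2 hp1
    have hpos : 0 < w1 p ^ 2 := by have := hsimple p hp.1 hp.2; positivity
    have sg : ∀ ξ, p - s / 2 < ξ → ξ < p + s / 2 → 0 < w1 ξ * w1 p := by
      intro ξ h1 h2
      have := hs2 p hp ξ ⟨by linarith, by linarith⟩ (by rw [abs_le]; constructor <;> linarith)
      linarith
    have w1p : w (p - s / 2) * w1 p < 0 := by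
      obtain ⟨ξ, hξ, h1⟩ := mvt w w1 cw dw (p - s / 2) p (by linarith) (by linarith) hp.1.2
      have := sg ξ hξ.1 (by linarith [hξ.2])
      rw [hp.2] at h1
      have h2 : w (p - s / 2) * w1 p = - (w1 ξ * w1 p) * (s / 2) := by
        have : w (p - s / 2) = - (w1 ξ * (s / 2)) := by linarith
        rw [this]; ring
      rw [h2]
      nlinarith
    have w2p : 0 < w (p + s / 2) * w1 p := by
      obtain ⟨ξ, hξ, h1⟩ := mvt w w1 cw dw p (p + s / 2) hp.1.1 (by linarith) (by linarith)
      have := sg ξ (by linarith [hξ.1]) hξ.2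
      rw [hp.2] at h1
      have h2 : w (p + s / 2) * w1 p = (w1 ξ * w1 p) * (s / 2) := by
        have : w (p + s / 2) = (w1 ξ * (s / 2)) := by linarith
        rw [this]; ring
      rw [h2]
      positivity
    have t1 := (hU.tendsto_at (x := p - s / 2) ⟨by linarith, by linarith⟩).mul_const (w1 p)
    have t2 := (hU.tendsto_at (x := p + s / 2) ⟨by linarith, by linarith⟩).mul_const (w1 p)
    filter_upwards [t1.eventually (eventually_lt_nhds w1p), t2.eventually (eventually_gt_nhds w2p)]
      with n h1 h2 _ using ⟨h1, h2⟩
  filter_upwards [n1, n2, n3] with n hn1 hn2 hn3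
  have hex : ∀ p ∈ Z, ∃ z ∈ Set.Icc a 1, u n z = 0 ∧ |z - p| < s := by
    intro p hp
    by_cases hp1 : p = 1
    · exact ⟨1, hp1 ▸ hp.1, uone n, by rw [hp1]; simpa using hs0⟩
    obtain ⟨k1, k2⟩ := hs3 p hp
    replace k2 := k2 hp1
    obtain ⟨g1, g2⟩ := hn3 p hp hp1
    obtain ⟨z, hz, hz0⟩ := exists_zero_of_sign (a := p - s / 2) (b := p + s / 2) (u := u n) (by linarith)
      ((cu n).mono (Icc_subset_Icc (by linarith) (by linarith))) (by
        rcases lt_or_ge (w1 p) 0 with hneg | hneg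
        · right; constructor <;> nlinarith
        · left; constructor
          · by_contra hcon; push Not at hcon; nlinarith
          · by_contra hcon; push Not at hcon; nlinarith)
    refine ⟨z, ⟨by linarith [hz.1], by linarith [hz.2]⟩, hz0, ?_⟩
    rw [abs_lt]; constructor <;> linarith [hz.1, hz.2]
  have huniq : ∀ p ∈ Z, ∀ z ∈ Set.Icc a 1, ∀ z' ∈ Set.Icc a 1, |z - p| < s → |z' - p| < s →
      u n z = 0 → u n z' = 0 → ¬ z < z' := by
    intro p hp z hz z' hz' h1 h2 h3 h4 hlt
    obtain ⟨ξ, hξ, h5⟩ := mvt (u n) (v n) (cu n) (du n) z z' hz.1 hlt hz'.2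
    rw [h3, h4] at h5
    have h6 : v n ξ = 0 := by
      have : v n ξ * (z' - z) = 0 := by linarith
      rcases mul_eq_zero.1 this with h | h
      · exact h
      · linarith
    rw [abs_lt] at h1 h2
    have := hn2 p hp ξ ⟨by linarith [hξ.1, hz.1], by linarith [hξ.2, hz'.2]⟩
      (by rw [abs_le]; constructor <;> linarith [hξ.1, hξ.2])
    rw [h6] at this
    simp at this
  choose! f hf1 hf2 hf3 using hex
  refine Set.ncard_congr (fun p _ => f p) (fun p hp => ⟨hf1 p hp, hf2 p hp⟩) ?_ ?_
  · intro p q hp hq hpq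
    by_contra hne
    have := hs1 p hp q hq hne
    have h1 := hf3 p hp
    have h2 := hf3 q hq
    rw [hpq] at h1
    rw [abs_lt] at h1 h2
    have : |p - q| < 2 * s := by rw [abs_lt]; constructor <;> linarith
    linarith
  · rintro z ⟨hz, hz0⟩
    by_cases hmem : z ∈ ⋃ p ∈ Z, Metric.ball p s
    · simp only [Set.mem_iUnion] at hmem
      obtain ⟨p, hp, hzp⟩ := hmem
      rw [Metric.mem_ball, Real.dist_eq] at hzp
      refine ⟨p, hp, ?_⟩
      rcases lt_trichotomy (f p) z with h | h | h
      · exact absurd h (huniq p hp _ (hf1 p hp) _ hz (hf3 p hp) hzp (hf2 p hp) hz0)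
      · exact h
      · exact absurd h (huniq p hp _ hz _ (hf1 p hp) hzp (hf3 p hp) hz0 (hf2 p hp))
    · have h1 := hc z ⟨hz, hmem⟩
      have h2 := hn1 z hz
      rw [Real.dist_eq, hz0, sub_zero] at h2
      linarith

lemma RadSol.abs_le_half {l : ℝ} {w w1 : ℝ → ℝ} (h : RadSol l w w1) (hl : 0 < l)
    (hw0 : w 0 = -l / 2) (hw10 : w1 0 = 0) {r : ℝ} (hr : r ∈ Set.Icc (0:ℝ) 1) : |w r| ≤ l / 2 := by
  by_contra hcon
  push Not at hcon
  have he := h.energy le_rfl hr.1 hr.2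
  unfold En at he
  have h0 : |w 0| = l / 2 := by rw [hw0, abs_of_neg (by linarith)]; ring
  rw [← sq_abs (w r), ← sq_abs (w 0), h0, hw10] at he
  have h1 : (l / 2) ^ 3 < |w r| ^ 3 := by gcongr
  have h2 : (l / 2) ^ 2 < |w r| ^ 2 := by gcongr
  nlinarith [sq_nonneg (w1 r), mul_lt_mul_of_pos_left h2 hl]

theorem statement13 (m : ℕ) (hm : 2 ≤ m) (lamBar : ℝ) (hlamBar : 0 < lamBar)
    (lam : ℕ → ℝ) (hlam : Tendsto lam atTop (𝓝 lamBar))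
    (u u' u'' : ℕ → ℝ → ℝ) (r : ℕ → ℝ)
    (hsol : ∀ n, BNSol 6 (lam n) m (u n) (u' n) (u'' n))
    (hfz : ∀ n, IsFirstZero (u n) (r n))
    (hblow : Tendsto (fun n => u n 0) atTop atTop)
    (M : ℕ → ℝ) (hM : ∀ n, M n = sSup ((fun s => |u n s|) '' Set.Icc (r n) 1)) :
    ∃ w w' w'' : ℝ → ℝ,
      OverdetSol lamBar m w w' w'' ∧
      (∀ (lam₂ : ℝ) (w₂ w₂' w₂'' : ℝ → ℝ), OverdetSol lam₂ m w₂ w₂' w₂'' → lam₂ = lamBar) ∧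
      (∀ a : ℝ, 0 < a → a ≤ 1 →
        TendstoUniformlyOn (fun n s => u n s) w atTop (Set.Icc a 1) ∧
        TendstoUniformlyOn (fun n s => u' n s) w' atTop (Set.Icc a 1)) ∧
      Tendsto M atTop (𝓝 (lamBar / 2)) := by

  obtain ⟨d, F, h⟩ := seqData hm hlamBar hlam hsol hfz hblow
  obtain ⟨w, w1, hU, hw0, hw10, hn⟩ := h.limit
  have hR := h.limit_radSol hU hw0 hw10 hn
  have hd0 := h.d0
  have hd1 := h.d1
  have hF0 := h.F0
  have w00 : w 0 ≠ 0 := by rw [hw0]; linarith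
  have wneg : ∀ x ∈ Set.Icc 0 d, w x < 0 := by
    intro x hx
    have h1 := (abs_le.1 (hn x hx).1).2
    have h2 : F * x ^ 2 ≤ F * d ^ 2 := by have := hx.1; have := hx.2; gcongr
    linarith [h.dF]
  have wone : w 1 = 0 := by
    have t := (hU 1 one_pos).1.tendsto_at (x := 1) ⟨le_rfl, le_rfl⟩
    refine tendsto_nhds_unique t ?_
    have : (fun n => u n 1) = fun _ => 0 := funext h.one
    rw [this]; exact tendsto_const_nhds
  have hsub : Set.Icc d 1 ⊆ Set.Icc (0:ℝ) 1 := Icc_subset_Icc_left hd0.le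
  have hfin : {r | r ∈ Set.Icc d 1 ∧ w r = 0}.Finite :=
    (hR.finite_zeros w00).subset fun x hx => ⟨hsub hx.1, hx.2⟩
  have hcount := count_zeros (a := d) (hR.cu.mono hsub) (hR.cv.mono hsub)
    (fun x hx => hR.du x ⟨hd0.trans hx.1, hx.2⟩) (wneg d ⟨hd0.le, le_rfl⟩).ne wone
    (fun p hp hp0 => hR.simple w00 (hsub hp) hp0) hfin
    (fun n => (h.sol n).cu.mono hsub) (fun n x hx => (h.sol n).du x ⟨hd0.trans hx.1, hx.2⟩) h.one
    (hU d hd0).1 (hU d hd0).2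
  have hnod : {r : ℝ | r ∈ Set.Ioo (0:ℝ) 1 ∧ w r = 0}.ncard = m - 2 := by
    obtain ⟨n, ⟨hc, hrd⟩, hb⟩ :=
      ((hcount.and (h.hr.eventually (eventually_lt_nhds hd0))).and h.bd).exists
    have e1 : {r : ℝ | r ∈ Set.Ioo (0:ℝ) 1 ∧ w r = 0} = {r | r ∈ Set.Icc d 1 ∧ w r = 0} \ {1} := by
      ext x
      simp only [Set.mem_ofPred_eq, Set.mem_sdiff, Set.mem_singleton_iff]
      constructor
      · rintro ⟨hx, hx0⟩
        refine ⟨⟨⟨?_, hx.2.le⟩, hx0⟩, hx.2.ne⟩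
        by_contra hcon
        push Not at hcon
        exact (wneg x ⟨hx.1.le, hcon.le⟩).ne hx0
      · rintro ⟨⟨hx, hx0⟩, hx1⟩
        exact ⟨⟨hd0.trans_le hx.1, lt_of_le_of_ne hx.2 hx1⟩, hx0⟩
    have e2 : {x : ℝ | x ∈ Set.Ioo (0:ℝ) 1 ∧ u n x = 0} =
        insert (r n) ({x | x ∈ Set.Icc d 1 ∧ u n x = 0} \ {1}) := by
      ext x
      simp only [Set.mem_ofPred_eq, Set.mem_sdiff, Set.mem_singleton_iff, Set.mem_insert_iff]
      constructor
      · rintro ⟨hx, hx0⟩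
        rcases lt_trichotomy x (r n) with hlt | heq | hgt
        · exact absurd hx0 ((hfz n).2.2 x ⟨hx.1, hlt⟩)
        · exact Or.inl heq
        · right
          refine ⟨⟨⟨?_, hx.2.le⟩, hx0⟩, hx.2.ne⟩
          by_contra hcon
          push Not at hcon
          exact (hb x ⟨hgt, hcon.le⟩).1.ne hx0
      · rintro (heq | ⟨⟨hx, hx0⟩, hx1⟩)
        · rw [heq]; exact ⟨⟨h.rpos n, hrd.trans hd1⟩, h.rz n⟩
        · exact ⟨⟨hd0.trans_le hx.1, lt_of_le_of_ne hx.2 hx1⟩, hx0⟩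
    have hfn : {x | x ∈ Set.Icc d 1 ∧ u n x = 0}.Finite :=
      ((h.sol n).finite_zeros (hsol n).pos_zero.ne').subset fun x hx => ⟨hsub hx.1, hx.2⟩
    have c1 := Set.ncard_sdiff_singleton_of_mem
      (show (1:ℝ) ∈ {r | r ∈ Set.Icc d 1 ∧ w r = 0} from ⟨⟨hd1.le, le_rfl⟩, wone⟩)
    have c2 := Set.ncard_sdiff_singleton_of_mem
      (show (1:ℝ) ∈ {x | x ∈ Set.Icc d 1 ∧ u n x = 0} from ⟨⟨hd1.le, le_rfl⟩, h.one n⟩)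
    have c3 := (hsol n).nodal
    rw [e2, Set.ncard_insert_of_notMem (fun hmem => by
      have := hmem.1.1.1
      linarith) (hfn.subset sdiff_subset), c2] at c3
    rw [e1, c1, hc]
    omega
  have hOD : OverdetSol lamBar m w w1 (secondD lamBar w w1) := by
    refine ⟨hlamBar, fun r hr => hR.du_within hr, fun r hr => hR.dv_within hw10 hr, ?_, hw10, wone,
      hw0, hnod⟩
    intro r hr
    rw [secondD, if_neg hr.1.ne']
    ring
  refine ⟨w, w1, secondD lamBar w w1, hOD, ?_, fun a ha _ => hU a ha, ?_⟩
  · intro lam₂ w₂ w₂' w₂'' h2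
    exact le_antisymm (not_lt.1 (hOD.not_lt h2)) (not_lt.1 (h2.not_lt hOD))
  · have hbdd : ∀ n, BddAbove ((fun s => |u n s|) '' Set.Icc (r n) 1) := fun n =>
      (isCompact_Icc.image_of_continuousOn
        (((h.sol n).cu.mono (Icc_subset_Icc_left (h.rpos n).le)).abs)).bddAbove
    refine tendsto_order.2 ⟨fun b hb => ?_, fun b hb => ?_⟩
    · set δ := min d ((lamBar / 2 - b) / (2 * F)) with hδ
      have hq : 0 < (lamBar / 2 - b) / (2 * F) := div_pos (by linarith) (by linarith)
      have hδ0 : 0 < δ := lt_min hd0 hq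
      have hδd : δ ≤ d := min_le_left _ _
      have hδF : 2 * (F * δ) ≤ lamBar / 2 - b := by
        have : δ ≤ (lamBar / 2 - b) / (2 * F) := min_le_right _ _
        rw [le_div_iff₀ (by positivity)] at this
        linarith
      have hδF2 : F * δ ^ 2 ≤ F * δ := by
        have : δ ≤ 1 := hδd.trans hd1.le
        have : δ ^ 2 ≤ δ := by nlinarith
        gcongr
      have hb1 : b < |w δ| := by
        have h1 := (abs_le.1 (hn δ ⟨hδ0.le, hδd⟩).1).2
        have h2 := neg_le_abs (w δ)
        have : 0 < F * δ := by positivity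
        linarith
      have t := ((hU δ hδ0).1.tendsto_at (x := δ) ⟨le_rfl, hδd.trans hd1.le⟩).abs
      filter_upwards [t.eventually (eventually_gt_nhds hb1), h.hr.eventually (eventually_lt_nhds hδ0)]
        with n h1 h2
      rw [hM n]
      exact h1.trans_le (le_csSup (hbdd n) ⟨δ, ⟨h2.le, hδd.trans hd1.le⟩, rfl⟩)
    · set c := (lamBar / 2 + b) / 2 with hc
      have e1 := h.hX.eventually (eventually_lt_nhds (b := 4 * c) (by linarith))
      have e2 := Metric.tendstoUniformlyOn_iff.1 (hU d hd0).1 ((b - lamBar / 2) / 2) (by linarith)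
      filter_upwards [e1, e2, h.bd] with n h1 h2 h3
      rw [hM n]
      refine lt_of_le_of_lt (csSup_le ⟨_, 1, ⟨(hfz n).1.2, le_rfl⟩, rfl⟩ ?_) (show c < b by linarith)
      rintro y ⟨x, hx, rfl⟩
      show |u n x| ≤ c
      rcases le_or_gt x d with hxd | hxd
      · rcases hx.1.eq_or_lt with hx0 | hx0
        · rw [← hx0, h.rz n, abs_zero]; linarith
        · obtain ⟨g1, g2, -⟩ := h3 x ⟨hx0, hxd⟩
          rw [abs_of_neg g1]
          linarith
      · have h4 := h2 x ⟨hxd.le, hx.2⟩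
        rw [Real.dist_eq, abs_sub_comm] at h4
        have h5 := hR.abs_le_half hlamBar hw0 hw10 (r := x) ⟨(hd0.trans hxd).le, hx.2⟩
        have h6 := abs_sub_abs_le_abs_sub (u n x) (w x)
        linarith
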